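/- arXiv:2301.08681 — 10 statements merged into one kernel-verified Lean document; each statement's English description precedes it below -/
import Mathlib

section
/- Let L and N be bricks over Λ with Hom_Λ(L, N) = 0 and Hom_Λ(N, L) = 0. Then for every non-split short exact sequence 0 → L → M → N → 0 of Λ-modules, the middle term M is a brick. -/
/-- A bundled finite-dimensional module over the finite-dimensional `K`-algebra `Λ`
(finite-dimensionality over the base field is equivalent to being finitely
generated over `Λ`). -/
structure FDModule (Λ : Type) [Ring Λ] : Type 1 where
  carrier : Type
  [isAddCommGroup : AddCommGroup carrier]
  [isModule : Module Λ carrier]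
  [isFinite : Module.Finite Λ carrier]

attribute [instance] FDModule.isAddCommGroup FDModule.isModule FDModule.isFinite

/-- `M` is a brick: `M` is non-zero and every non-zero endomorphism of `M` is an
isomorphism. -/
def IsBrick {Λ : Type} [Ring Λ] (M : FDModule Λ) : Prop :=
  Nontrivial M.carrier ∧ ∀ f : M.carrier →ₗ[Λ] M.carrier, f = 0 ∨ Function.Bijective f

/-- `Hom_Λ(M, N) = 0`. -/
def NoHom {Λ : Type} [Ring Λ] (M N : FDModule Λ) : Prop :=
  ∀ f : M.carrier →ₗ[Λ] N.carrier, f = 0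

/-- `0 → L → M → N → 0` is a short exact sequence. -/
def IsShortExact {Λ : Type} [Ring Λ] {L M N : Type} [AddCommGroup L] [Module Λ L]
    [AddCommGroup M] [Module Λ M] [AddCommGroup N] [Module Λ N]
    (f : L →ₗ[Λ] M) (g : M →ₗ[Λ] N) : Prop :=
  Function.Injective f ∧ LinearMap.range f = LinearMap.ker g ∧ Function.Surjective g

/-- The short exact sequence with surjection `g` splits, i.e. `g` admits a
linear section. -/
def SESSplits {Λ : Type} [Ring Λ] {M N : Type} [AddCommGroup M] [Module Λ M]
    [AddCommGroup N] [Module Λ N] (g : M →ₗ[Λ] N) : Prop :=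
  ∃ s : N →ₗ[Λ] M, g.comp s = LinearMap.id

section Factorization

variable {R L M N P : Type*} [Ring R] [AddCommGroup L] [AddCommGroup M] [AddCommGroup N]
  [AddCommGroup P] [Module R L] [Module R M] [Module R N] [Module R P]

/-- A linear map killed by `g` factors through `f` when `0 → L → M → N` is exact. -/
lemma exists_comp_eq_of_exact_of_injective {f : L →ₗ[R] M} {g : M →ₗ[R] N}
    (hf : Function.Injective f) (hfg : Function.Exact f g) (h : P →ₗ[R] M)
    (hh : g ∘ₗ h = 0) : ∃ k : P →ₗ[R] L, f ∘ₗ k = h := by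
  have hmem (x : P) : h x ∈ LinearMap.range f := (hfg _).1 (LinearMap.congr_fun hh x)
  refine ⟨(LinearEquiv.ofInjective f hf).symm ∘ₗ h.codRestrict _ hmem, LinearMap.ext fun x ↦ ?_⟩
  exact congrArg Subtype.val
    ((LinearEquiv.ofInjective f hf).apply_symm_apply (h.codRestrict _ hmem x))

/-- A linear map killing `f` factors through `g` when `L → M → N → 0` is exact. -/
lemma exists_comp_eq_of_exact_of_surjective {f : L →ₗ[R] M} {g : M →ₗ[R] N}
    (hg : Function.Surjective g) (hfg : Function.Exact f g) (h : M →ₗ[R] P)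
    (hh : h ∘ₗ f = 0) : ∃ k : N →ₗ[R] P, k ∘ₗ g = h := by
  have hker : LinearMap.ker g ≤ LinearMap.ker h := by
    rw [hfg.linearMap_ker_eq]
    exact LinearMap.range_le_ker_iff.2 hh
  refine ⟨(LinearMap.ker g).liftQ h hker ∘ₗ (g.quotKerEquivOfSurjective hg).symm,
    LinearMap.ext fun x ↦ ?_⟩
  have hx : (g.quotKerEquivOfSurjective hg).symm (g x) = Submodule.Quotient.mk x :=
    (LinearEquiv.symm_apply_eq _).2 rfl
  simp [hx]

/-- The short five lemma for an endomorphism of a short exact sequence. -/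
lemma bijective_of_exact_of_bijective_of_bijective {f : L →ₗ[R] M} {g : M →ₗ[R] N}
    (hf : Function.Injective f) (hfg : Function.Exact f g) (hg : Function.Surjective g)
    {a : L →ₗ[R] L} {h : M →ₗ[R] M} {c : N →ₗ[R] N} (ha : f ∘ₗ a = h ∘ₗ f)
    (hc : c ∘ₗ g = g ∘ₗ h) (hba : Function.Bijective a) (hbc : Function.Bijective c) :
    Function.Bijective h := by
  have ha' (x : L) : f (a x) = h (f x) := LinearMap.congr_fun ha x
  have hc' (x : M) : c (g x) = g (h x) := LinearMap.congr_fun hc x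
  constructor
  · refine (injective_iff_map_eq_zero h).2 fun x hx ↦ ?_
    have hgx : g x = 0 := (map_eq_zero_iff c hbc.1).1 (by rw [hc', hx, map_zero])
    obtain ⟨y, rfl⟩ := (hfg x).1 hgx
    have hy : y = 0 := (map_eq_zero_iff a hba.1).1 ((map_eq_zero_iff f hf).1 (by rw [ha', hx]))
    rw [hy, map_zero]
  · intro m
    obtain ⟨n, hn⟩ := hbc.2 (g m)
    obtain ⟨x, rfl⟩ := hg n
    obtain ⟨y, hy⟩ := (hfg (m - h x)).1 (by rw [map_sub, ← hc', hn, sub_self])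
    obtain ⟨z, rfl⟩ := hba.2 y
    exact ⟨f z + x, by rw [map_add, ← ha', hy, sub_add_cancel]⟩

end Factorization

/-- if `L` and `N` are bricks with `Hom(L, N) = Hom(N, L) = 0`, then
the middle term of every non-split short exact sequence `0 → L → M → N → 0` is a
brick. -/
theorem statement_0 (K : Type) [Field K] (Λ : Type) [Ring Λ] [Algebra K Λ]
    [FiniteDimensional K Λ]
    (L N : FDModule Λ) (hL : IsBrick L) (hN : IsBrick N)
    (hLN : NoHom L N) (hNL : NoHom N L)
    (M : FDModule Λ) (f : L.carrier →ₗ[Λ] M.carrier) (g : M.carrier →ₗ[Λ] N.carrier)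
    (hse : IsShortExact f g) (hns : ¬ SESSplits g) :
    IsBrick M := by
  obtain ⟨hf, hrk, hg⟩ := hse
  have hfg : Function.Exact f g := LinearMap.exact_iff.2 hrk.symm
  have : Nontrivial L.carrier := hL.1
  refine ⟨hf.nontrivial, fun h ↦ ?_⟩
  obtain ⟨a, ha⟩ := exists_comp_eq_of_exact_of_injective hf hfg (h ∘ₗ f) (hLN _)
  obtain ⟨c, hc⟩ := exists_comp_eq_of_exact_of_surjective hg hfg (g ∘ₗ h) (hLN _)
  rcases hL.2 a with rfl | hba
  · left
    obtain ⟨k, rfl⟩ := exists_comp_eq_of_exact_of_surjective hg hfg h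
      (by rw [← ha, LinearMap.comp_zero])
    rcases hN.2 (g ∘ₗ k) with hgk | hgk
    · obtain ⟨r, rfl⟩ := exists_comp_eq_of_exact_of_injective hf hfg k hgk
      rw [hNL r, LinearMap.comp_zero, LinearMap.zero_comp]
    · exact absurd ⟨k ∘ₗ (LinearEquiv.ofBijective _ hgk).symm, LinearMap.ext
        (LinearEquiv.ofBijective _ hgk).apply_symm_apply⟩ hns
  · rcases hN.2 c with rfl | hbc
    · obtain ⟨r, rfl⟩ := exists_comp_eq_of_exact_of_injective hf hfg h
        (by rw [← hc, LinearMap.zero_comp])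
      have hr (x : L.carrier) : r (f x) = a x := hf (LinearMap.congr_fun ha x).symm
      have hret : ∃ l : M.carrier →ₗ[Λ] L.carrier, l ∘ₗ f = LinearMap.id :=
        ⟨(LinearEquiv.ofBijective a hba).symm ∘ₗ r,
          LinearMap.ext fun x ↦ (LinearEquiv.ofBijective a hba).symm_apply_eq.2 (hr x)⟩
      exact absurd (((hfg.split_tfae hf hg).out 0 1).2 hret) hns
    · exact .inr (bijective_of_exact_of_bijective_of_bijective hf hfg hg ha hc hba hbc)
end

section
/- Let B_1, …, B_r be a maximal backwards Hom-orthogonal sequence of bricks over Λ and let 1 ≤ i ≤ r − 1. If Hom_Λ(B_i, B_{i+1}) = 0, then every short exact sequence 0 → B_i → M → B_{i+1} → 0 of Λ-modules splits (i.e. Ext^1_Λ(B_{i+1}, B_i) = 0). -/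
/-- The sequence of modules `B 0, …, B (r-1)` is backwards Hom-orthogonal:
`Hom(B j, B i) = 0` whenever `i < j`. -/
def BackwardsHomOrthogonal {Λ : Type} [Ring Λ] {r : ℕ} (B : Fin r → FDModule Λ) : Prop :=
  ∀ i j : Fin r, i < j → NoHom (B j) (B i)

/-- `B` is a maximal backwards Hom-orthogonal sequence of bricks: each entry is a
brick, the sequence is backwards Hom-orthogonal, and for every brick `C` and every
position `0 ≤ k ≤ r`, inserting `C` after the first `k` entries destroys backwards
Hom-orthogonality. -/
def IsMaximalBHO {Λ : Type} [Ring Λ] {r : ℕ} (B : Fin r → FDModule Λ) : Prop :=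
  (∀ i, IsBrick (B i)) ∧ BackwardsHomOrthogonal B ∧
    ∀ C : FDModule Λ, IsBrick C → ∀ k : ℕ, k ≤ r →
      ¬ ((∀ i : Fin r, (i : ℕ) < k → NoHom C (B i)) ∧
         (∀ j : Fin r, k ≤ (j : ℕ) → NoHom (B j) C))

section ShortExact

variable {Λ : Type} [Ring Λ] {L M N P : Type} [AddCommGroup L] [Module Λ L]
  [AddCommGroup M] [Module Λ M] [AddCommGroup N] [Module Λ N] [AddCommGroup P] [Module Λ P]
  {f : L →ₗ[Λ] M} {g : M →ₗ[Λ] N}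

/-- A map vanishing on the kernel term of a short exact sequence factors through the quotient. -/
lemma IsShortExact.exists_desc (h : IsShortExact f g) (u : M →ₗ[Λ] P) (hu : u.comp f = 0) :
    ∃ v : N →ₗ[Λ] P, u = v.comp g := by
  have hle : LinearMap.ker g ≤ LinearMap.ker u := by
    rw [← h.2.1]
    exact LinearMap.range_le_ker_iff.2 hu
  refine ⟨((LinearMap.ker g).liftQ u hle).comp
    (g.quotKerEquivOfSurjective h.2.2).symm.toLinearMap, LinearMap.ext fun x => ?_⟩
  have hx : (g.quotKerEquivOfSurjective h.2.2).symm (g x) = (LinearMap.ker g).mkQ x := by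
    rw [LinearEquiv.symm_apply_eq]
    rfl
  simp [hx]

/-- A map killed by the surjection of a short exact sequence factors through the kernel term. -/
lemma IsShortExact.exists_lift (h : IsShortExact f g) (u : P →ₗ[Λ] M) (hu : g.comp u = 0) :
    ∃ v : P →ₗ[Λ] L, u = f.comp v := by
  have hmem : ∀ x, u x ∈ LinearMap.range f := fun x => by
    rw [h.2.1]
    exact LinearMap.congr_fun hu x
  refine ⟨(LinearEquiv.ofInjective f h.1).symm.toLinearMap.comp (u.codRestrict _ hmem),
    LinearMap.ext fun x => ?_⟩
  have := congrArg Subtype.val ((LinearEquiv.ofInjective f h.1).apply_symm_apply ⟨u x, hmem x⟩)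
  exact this.symm

lemma IsShortExact.comp_eq_zero (h : IsShortExact f g) : g.comp f = 0 :=
  LinearMap.range_le_ker_iff.1 h.2.1.le

lemma SESSplits.of_bijective_comp (s : N →ₗ[Λ] M) (hs : Function.Bijective (g.comp s)) :
    SESSplits g :=
  ⟨s.comp (LinearEquiv.ofBijective _ hs).symm.toLinearMap, LinearMap.ext fun x =>
    (LinearEquiv.ofBijective _ hs).apply_symm_apply x⟩

lemma IsShortExact.splits_of_bijective_comp (h : IsShortExact f g) (p : M →ₗ[Λ] L)
    (hp : Function.Bijective (p.comp f)) : SESSplits g := by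
  set e := LinearEquiv.ofBijective _ hp
  obtain ⟨s, hs⟩ := h.exists_desc (LinearMap.id - f.comp (e.symm.toLinearMap.comp p)) (by
    ext x
    have hx : e.symm (p (f x)) = x := e.symm_apply_apply x
    simp [hx])
  refine ⟨s, LinearMap.ext fun y => ?_⟩
  obtain ⟨x, rfl⟩ := h.2.2 y
  have hx : x - f (e.symm (p x)) = s (g x) := LinearMap.congr_fun hs x
  have hgf : g (f (e.symm (p x))) = 0 := LinearMap.congr_fun h.comp_eq_zero _
  simp [← hx, hgf]

/-- The middle map of an endomorphism of a short exact sequence is bijective when the outer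
maps are. -/
lemma IsShortExact.bijective_of_bijective (h : IsShortExact f g) {u : M →ₗ[Λ] M}
    {a : L →ₗ[Λ] L} {b : N →ₗ[Λ] N} (ha : Function.Bijective a) (hb : Function.Bijective b)
    (hfa : u.comp f = f.comp a) (hgb : g.comp u = b.comp g) : Function.Bijective u := by
  have hfa' : ∀ x, u (f x) = f (a x) := LinearMap.congr_fun hfa
  have hgb' : ∀ x, g (u x) = b (g x) := LinearMap.congr_fun hgb
  have hmem : ∀ x, g x = 0 → ∃ y, f y = x := fun x hx => by
    have : x ∈ LinearMap.range f := by rw [h.2.1]; exact hx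
    exact this
  constructor
  · rw [injective_iff_map_eq_zero]
    intro x hx
    obtain ⟨y, rfl⟩ := hmem x (hb.1 (by rw [← hgb', hx, map_zero, map_zero]))
    have hy : a y = 0 := h.1 (by rw [← hfa', hx, map_zero])
    rw [ha.1 (hy.trans (map_zero a).symm), map_zero]
  · intro z
    obtain ⟨n, hn⟩ := hb.2 (g z)
    obtain ⟨x, rfl⟩ := h.2.2 n
    obtain ⟨y, hy⟩ := hmem (z - u x) (by rw [map_sub, hgb', hn, sub_self])
    obtain ⟨w, rfl⟩ := ha.2 y
    exact ⟨x + f w, by rw [map_add, hfa', hy, add_sub_cancel]⟩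

end ShortExact

section Bricks

variable {Λ : Type} [Ring Λ] {X Y M : FDModule Λ}
  {f : X.carrier →ₗ[Λ] M.carrier} {g : M.carrier →ₗ[Λ] Y.carrier}

lemma NoHom.of_extension_left (h : IsShortExact f g) {P : FDModule Λ} (hX : NoHom X P)
    (hY : NoHom Y P) : NoHom M P := fun u => by
  obtain ⟨v, rfl⟩ := h.exists_desc u (hX _)
  rw [hY v, LinearMap.zero_comp]

lemma NoHom.of_extension_right (h : IsShortExact f g) {P : FDModule Λ} (hX : NoHom P X)
    (hY : NoHom P Y) : NoHom P M := fun u => by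
  obtain ⟨v, rfl⟩ := h.exists_lift u (hY _)
  rw [hX v, LinearMap.comp_zero]

/-- A non-split extension of `Y` by a brick `X` with `Hom(Y, X) = 0` has no maps to `X`. -/
lemma IsBrick.noHom_extension_sub (hX : IsBrick X) (h : IsShortExact f g) (hns : ¬ SESSplits g)
    (hYX : NoHom Y X) : NoHom M X := fun u => by
  rcases hX.2 (u.comp f) with h0 | hb
  · obtain ⟨v, rfl⟩ := h.exists_desc u h0
    rw [hYX v, LinearMap.zero_comp]
  · exact absurd (h.splits_of_bijective_comp u hb) hns

/-- A non-split extension of a brick `Y` by `X` with `Hom(Y, X) = 0` has no maps from `Y`. -/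
lemma IsBrick.noHom_quotient_extension (hY : IsBrick Y) (h : IsShortExact f g)
    (hns : ¬ SESSplits g) (hYX : NoHom Y X) : NoHom Y M := fun u => by
  rcases hY.2 (g.comp u) with h0 | hb
  · obtain ⟨v, rfl⟩ := h.exists_lift u h0
    rw [hYX v, LinearMap.comp_zero]
  · exact absurd (SESSplits.of_bijective_comp u hb) hns

/-- A non-split extension of Hom-orthogonal bricks is a brick. -/
lemma IsBrick.extension (hX : IsBrick X) (hY : IsBrick Y) (h : IsShortExact f g)
    (hns : ¬ SESSplits g) (hXY : NoHom X Y) (hYX : NoHom Y X) : IsBrick M := by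
  refine ⟨?_, fun u => ?_⟩
  · have := hY.1
    exact h.2.2.nontrivial
  obtain ⟨a, ha⟩ := h.exists_lift (u.comp f) (hXY _)
  obtain ⟨b, hb⟩ := h.exists_desc (g.comp u) (hXY _)
  rcases hX.2 a with rfl | ha'
  · left
    obtain ⟨v, rfl⟩ := h.exists_desc u (by rw [ha, LinearMap.comp_zero])
    rw [hY.noHom_quotient_extension h hns hYX v, LinearMap.zero_comp]
  rcases hY.2 b with rfl | hb'
  · left
    obtain ⟨v, rfl⟩ := h.exists_lift u (by rw [hb, LinearMap.zero_comp])
    rw [hX.noHom_extension_sub h hns hYX v, LinearMap.comp_zero]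
  · exact Or.inr (h.bijective_of_bijective ha' hb' ha hb)

end Bricks

/-- in a maximal backwards Hom-orthogonal sequence of bricks, if
`Hom(B i, B (i+1)) = 0` then `Ext¹(B (i+1), B i) = 0`, i.e. every short exact
sequence `0 → B i → M → B (i+1) → 0` splits. -/
theorem statement_1 (K : Type) [Field K] (Λ : Type) [Ring Λ] [Algebra K Λ]
    [FiniteDimensional K Λ]
    {r : ℕ} (B : Fin r → FDModule Λ) (hmax : IsMaximalBHO B)
    (i : Fin r) (hi : (i : ℕ) + 1 < r)
    (h0 : NoHom (B i) (B ⟨(i : ℕ) + 1, hi⟩)) :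
    ∀ (M : FDModule Λ) (f : (B i).carrier →ₗ[Λ] M.carrier)
      (g : M.carrier →ₗ[Λ] (B ⟨(i : ℕ) + 1, hi⟩).carrier),
      IsShortExact f g → SESSplits g := by
  intro M f g h
  by_contra hns
  obtain ⟨hbrick, horth, hins⟩ := hmax
  have hYX : NoHom (B ⟨(i : ℕ) + 1, hi⟩) (B i) := horth _ _ (Fin.lt_def.2 (Nat.lt_succ_self _))
  refine hins M ((hbrick i).extension (hbrick _) h hns h0 hYX) ((i : ℕ) + 1) hi.le
    ⟨fun j hj => ?_, fun j hj => ?_⟩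
  · rcases (Nat.lt_succ_iff.1 hj).lt_or_eq with hlt | heq
    · exact NoHom.of_extension_left h (horth j i hlt)
        (horth j _ (Fin.lt_def.2 hj))
    · obtain rfl : j = i := Fin.ext heq
      exact (hbrick j).noHom_extension_sub h hns hYX
  · rcases hj.lt_or_eq with hlt | heq
    · exact NoHom.of_extension_right h (horth i j (Fin.lt_def.2 (Nat.lt_of_succ_le hj)))
        (horth _ j (Fin.lt_def.2 hlt))
    · obtain rfl : (⟨(i : ℕ) + 1, hi⟩ : Fin r) = j := Fin.ext heq
      exact (hbrick _).noHom_quotient_extension h hns hYX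
end

section
/- Let B_1, …, B_r be a maximal backwards Hom-orthogonal sequence of bricks over Λ and let 1 ≤ i ≤ r − 1. The sequence B_1, …, B_{i−1}, B_{i+1}, B_i, B_{i+2}, …, B_r obtained by swapping B_i and B_{i+1} is again a maximal backwards Hom-orthogonal sequence of bricks if and only if Hom_Λ(B_i, B_{i+1}) = 0 and every short exact sequence 0 → B_{i+1} → M → B_i → 0 of Λ-modules splits (i.e. Ext^1_Λ(B_i, B_{i+1}) = 0). -/
section Factoring

variable {Λ : Type} [Ring Λ] {A V Q Z : Type}
  [AddCommGroup A] [Module Λ A] [AddCommGroup V] [Module Λ V]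
  [AddCommGroup Q] [Module Λ Q] [AddCommGroup Z] [Module Λ Z]

theorem exists_comp_eq_of_ker_le {p : V →ₗ[Λ] Q} (hp : Function.Surjective p) {f : V →ₗ[Λ] Z}
    (h : LinearMap.ker p ≤ LinearMap.ker f) : ∃ f' : Q →ₗ[Λ] Z, f'.comp p = f := by
  refine ⟨((LinearMap.ker p).liftQ f h).comp
    (p.quotKerEquivOfSurjective hp).symm.toLinearMap, ?_⟩
  ext v
  have : (p.quotKerEquivOfSurjective hp).symm (p v) = (LinearMap.ker p).mkQ v := by
    rw [LinearEquiv.symm_apply_eq]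
    rfl
  simp [this]

theorem exists_comp_eq_of_range_le {f : A →ₗ[Λ] V} (hf : Function.Injective f) {h : Z →ₗ[Λ] V}
    (hr : LinearMap.range h ≤ LinearMap.range f) : ∃ h' : Z →ₗ[Λ] A, f.comp h' = h := by
  refine ⟨(LinearEquiv.ofInjective f hf).symm.toLinearMap.comp
    (h.codRestrict (LinearMap.range f) fun z => hr ⟨z, rfl⟩), ?_⟩
  ext z
  have := (LinearEquiv.ofInjective f hf).apply_symm_apply
    (h.codRestrict (LinearMap.range f) (fun z => hr ⟨z, rfl⟩) z)
  exact congrArg Subtype.val this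

end Factoring

/-- There are no non-zero maps from `M` to a member of `S`. -/
def LeftPerp {Λ : Type} [Ring Λ] (S : Set (FDModule Λ)) (M : Type) [AddCommGroup M]
    [Module Λ M] : Prop :=
  ∀ Z ∈ S, ∀ f : M →ₗ[Λ] Z.carrier, f = 0

/-- There are no non-zero maps from a member of `S` to `M`. -/
def RightPerp {Λ : Type} [Ring Λ] (S : Set (FDModule Λ)) (M : Type) [AddCommGroup M]
    [Module Λ M] : Prop :=
  ∀ Z ∈ S, ∀ f : Z.carrier →ₗ[Λ] M, f = 0

section Perp

variable {Λ : Type} [Ring Λ] {S : Set (FDModule Λ)} {A V Q : Type}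
  [AddCommGroup A] [Module Λ A] [AddCommGroup V] [Module Λ V]
  [AddCommGroup Q] [Module Λ Q]

theorem LeftPerp.of_surjective (h : LeftPerp S V) {p : V →ₗ[Λ] Q}
    (hp : Function.Surjective p) : LeftPerp S Q := by
  intro Z hZ f
  have := h Z hZ (f.comp p)
  ext q
  obtain ⟨v, rfl⟩ := hp q
  exact LinearMap.congr_fun this v

theorem RightPerp.of_injective (h : RightPerp S V) {a : A →ₗ[Λ] V}
    (ha : Function.Injective a) : RightPerp S A := by
  intro Z hZ f
  have := h Z hZ (a.comp f)
  ext z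
  apply ha
  simpa using LinearMap.congr_fun this z

theorem LeftPerp.of_extension (hA : LeftPerp S A) (hQ : LeftPerp S Q) {a : A →ₗ[Λ] V}
    {p : V →ₗ[Λ] Q} (hp : Function.Surjective p)
    (h : LinearMap.ker p ≤ LinearMap.range a) : LeftPerp S V := by
  intro Z hZ f
  obtain ⟨f', rfl⟩ := exists_comp_eq_of_ker_le hp (f := f) (by
    intro v hv
    obtain ⟨x, rfl⟩ := h hv
    exact LinearMap.congr_fun (hA Z hZ (f.comp a)) x)
  rw [hQ Z hZ f', LinearMap.zero_comp]

theorem RightPerp.of_extension (hA : RightPerp S A) (hQ : RightPerp S Q) {a : A →ₗ[Λ] V}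
    {p : V →ₗ[Λ] Q} (ha : Function.Injective a)
    (h : LinearMap.ker p ≤ LinearMap.range a) : RightPerp S V := by
  intro Z hZ f
  obtain ⟨f', rfl⟩ := exists_comp_eq_of_range_le ha (h := f) (by
    rintro _ ⟨z, rfl⟩
    exact h (LinearMap.congr_fun (hQ Z hZ (p.comp f)) z))
  rw [hA Z hZ f', LinearMap.comp_zero]

/-- The torsion radical of a submodule `N ≤ V` for the torsion class `LeftPerp S`. -/
theorem exists_torsion_radical [IsNoetherian Λ V] (S : Set (FDModule Λ)) (N : Submodule Λ V) :
    ∃ U ≤ N, LeftPerp S U ∧ ∀ (Z : Type) [AddCommGroup Z] [Module Λ Z], LeftPerp S Z →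
      ∀ φ : Z →ₗ[Λ] V ⧸ U, LinearMap.range φ ≤ N.map U.mkQ → φ = 0 := by
  obtain ⟨U, ⟨hUN, hU⟩, hmax⟩ := set_has_maximal_iff_noetherian.2 ‹IsNoetherian Λ V›
    {U : Submodule Λ V | U ≤ N ∧ LeftPerp S U} ⟨⊥, bot_le, fun Z _ f => by
      ext x
      rw [Subsingleton.elim x 0]
      simp⟩
  refine ⟨U, hUN, hU, fun Z _ _ hZ φ hφ => ?_⟩
  set W := (LinearMap.range φ).comap U.mkQ with hW
  have hUW : U ≤ W := fun u hu => by
    have : U.mkQ u = 0 := by simpa using hu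
    simp only [hW, Submodule.mem_comap, this, Submodule.zero_mem]
  have hWN : W ≤ N := fun w hw => by
    obtain ⟨n, hn, hnw⟩ := hφ hw
    have : n - w ∈ U := by
      rw [← Submodule.ker_mkQ U, LinearMap.mem_ker, map_sub, hnw, sub_self]
    have := N.sub_mem hn (hUN this)
    simpa using this
  have hWS : LeftPerp S W := by
    refine LeftPerp.of_extension (A := U) (Q := LinearMap.range φ)
      (a := Submodule.inclusion hUW) (p := U.mkQ.restrict fun w hw => hw) hU
      (hZ.of_surjective φ.surjective_rangeRestrict) ?_ ?_
    · rintro ⟨q, hq⟩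
      obtain ⟨v, rfl⟩ := U.mkQ_surjective q
      exact ⟨⟨v, hq⟩, rfl⟩
    · rintro ⟨w, hw⟩ hk
      have h0 : U.mkQ w = 0 := congrArg Subtype.val (LinearMap.mem_ker.1 hk)
      have : w ∈ U := by simpa using h0
      exact ⟨⟨w, this⟩, rfl⟩
  have hle : W ≤ U := by
    by_contra hn
    exact hmax W ⟨hWN, hWS⟩ (lt_of_le_not_ge hUW hn)
  ext z
  obtain ⟨v, hv⟩ := U.mkQ_surjective (φ z)
  have : v ∈ U := hle (show U.mkQ v ∈ LinearMap.range φ from hv ▸ ⟨z, rfl⟩)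
  rw [← hv]
  simpa using this

end Perp

section Bricks

variable {Λ : Type} [Ring Λ] [IsArtinianRing Λ]

theorem exists_brick_submodule_quotient (M : Type) [AddCommGroup M] [Module Λ M]
    [Module.Finite Λ M] [Nontrivial M] :
    ∃ (C : FDModule Λ) (a : C.carrier →ₗ[Λ] M) (p : M →ₗ[Λ] C.carrier),
      IsBrick C ∧ Function.Injective a ∧ Function.Surjective p := by
  obtain ⟨N, ⟨hN, p, hp⟩, hmin⟩ := IsArtinian.set_has_minimal
    {N : Submodule Λ M | N ≠ ⊥ ∧ ∃ p : M →ₗ[Λ] N, Function.Surjective p}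
    ⟨⊤, top_ne_bot, Submodule.topEquiv.symm.toLinearMap, Submodule.topEquiv.symm.surjective⟩
  refine ⟨⟨N⟩, N.subtype, p, ⟨(Submodule.nontrivial_iff_ne_bot).2 hN, fun f => ?_⟩,
    N.subtype_injective, hp⟩
  change N →ₗ[Λ] N at f
  by_cases hf : f = 0
  · exact Or.inl hf
  right
  set h : N →ₗ[Λ] M := N.subtype.comp f with hh
  have hle : LinearMap.range h ≤ N := by
    rintro _ ⟨x, rfl⟩
    exact (f x).2
  have hne : LinearMap.range h ≠ ⊥ := by
    intro h0
    apply hf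
    ext x
    exact LinearMap.congr_fun (LinearMap.range_eq_bot.1 h0) x
  have heq : LinearMap.range h = N := by
    by_contra hn
    exact hmin _ ⟨hne, h.rangeRestrict.comp p, h.surjective_rangeRestrict.comp hp⟩
      (lt_of_le_of_ne hle hn)
  have hs : Function.Surjective f := by
    rintro ⟨y, hy⟩
    obtain ⟨x, hx⟩ : y ∈ LinearMap.range h := heq.symm ▸ hy
    exact ⟨x, Subtype.ext hx⟩
  exact IsNoetherian.bijective_of_surjective_endomorphism f hs

end Bricks

section Core

variable {Λ : Type} [Ring Λ] [IsArtinianRing Λ] {L R : Set (FDModule Λ)} {X Y : FDModule Λ}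

theorem exists_surjective_to_brick (hY : IsBrick Y) (hYR : RightPerp R Y.carrier)
    (hYL : LeftPerp L Y.carrier) (hRL : ∀ Z ∈ R, LeftPerp L Z.carrier)
    (h1 : ∀ M : FDModule Λ, LeftPerp L M.carrier → RightPerp (insert Y R) M.carrier →
      Subsingleton M.carrier)
    (h2 : ∀ M : FDModule Λ, LeftPerp (insert Y L) M.carrier → RightPerp R M.carrier →
      Subsingleton M.carrier)
    (N : Type) [AddCommGroup N] [Module Λ N] [Module.Finite Λ N] [Nontrivial N]
    (hNL : LeftPerp L N) (hNR : RightPerp R N) :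
    ∃ p : N →ₗ[Λ] Y.carrier, Function.Surjective p ∧ LeftPerp L (LinearMap.ker p) := by
  obtain ⟨p, hp⟩ : ∃ p : N →ₗ[Λ] Y.carrier, p ≠ 0 := by
    by_contra! hn
    refine not_subsingleton N (h2 ⟨N⟩ ?_ hNR)
    rintro Z (rfl | hZ) f
    · exact hn f
    · exact hNL Z hZ f
  have hps : Function.Surjective p := by
    obtain ⟨h, hh⟩ : ∃ h : Y.carrier →ₗ[Λ] LinearMap.range p, h ≠ 0 := by
      by_contra! hn
      have : Subsingleton (LinearMap.range p) := by
        refine h1 ⟨LinearMap.range p⟩ (hNL.of_surjective p.surjective_rangeRestrict) ?_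
        rintro Z (rfl | hZ) f
        · exact hn f
        · exact hYR.of_injective (LinearMap.range p).subtype_injective Z hZ f
      exact hp (LinearMap.range_eq_bot.1 (Submodule.subsingleton_iff_eq_bot.1 this))
    rcases hY.2 ((LinearMap.range p).subtype.comp h) with h0 | hb
    · refine absurd ?_ hh
      ext y
      exact LinearMap.congr_fun h0 y
    · intro y
      obtain ⟨x, hx⟩ := hb.2 y
      obtain ⟨n, hn⟩ := (h x).2
      exact ⟨n, hn.trans hx⟩
  refine ⟨p, hps, ?_⟩
  obtain ⟨U, hUK, hU, hrad⟩ := exists_torsion_radical L (LinearMap.ker p)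
  set q : N ⧸ U →ₗ[Λ] Y.carrier := U.liftQ p hUK with hq
  have hker : ∀ v, q v = 0 → v ∈ (LinearMap.ker p).map U.mkQ := by
    intro v hv
    obtain ⟨n, rfl⟩ := U.mkQ_surjective v
    exact ⟨n, hv, rfl⟩
  have hqs : Function.Surjective q := fun y => by
    obtain ⟨n, rfl⟩ := hps y
    exact ⟨U.mkQ n, rfl⟩
  have hQL : LeftPerp L (N ⧸ U) := hNL.of_surjective U.mkQ_surjective
  have hzero : ∀ Z : FDModule Λ, LeftPerp L Z.carrier → ∀ φ : Z.carrier →ₗ[Λ] N ⧸ U,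
      q.comp φ = 0 → φ = 0 := by
    intro Z hZ φ h
    refine hrad _ hZ φ ?_
    rintro _ ⟨z, rfl⟩
    exact hker _ (LinearMap.congr_fun h z)
  have hQR : RightPerp R (N ⧸ U) := fun Z hZ φ =>
    hzero Z (hRL Z hZ) φ (hYR Z hZ _)
  have hnt : ¬ Subsingleton (N ⧸ U) := fun hs => by
    have := hY.1
    exact not_subsingleton Y.carrier hqs.subsingleton
  obtain ⟨h, hh⟩ : ∃ h : Y.carrier →ₗ[Λ] N ⧸ U, h ≠ 0 := by
    by_contra! hn
    refine hnt (h1 ⟨N ⧸ U⟩ hQL ?_)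
    rintro Z (rfl | hZ) f
    · exact hn f
    · exact hQR Z hZ f
  have hb : Function.Bijective (q.comp h) :=
    (hY.2 (q.comp h)).resolve_left fun h0 => hh (hzero Y hYL h h0)
  let e := LinearEquiv.ofBijective (q.comp h) hb
  let ε : N ⧸ U →ₗ[Λ] N ⧸ U := LinearMap.id - h.comp (e.symm.toLinearMap.comp q)
  have hε : ε = 0 := by
    refine hzero ⟨N ⧸ U⟩ hQL ε ?_
    apply LinearMap.ext
    intro v
    have : q (h (e.symm (q v))) = q v := e.apply_symm_apply (q v)
    simp [ε, this]
  have hKU : LinearMap.ker p ≤ U := by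
    intro n hn
    have hq0 : q (U.mkQ n) = 0 := hn
    have := LinearMap.congr_fun hε (U.mkQ n)
    simp only [ε, LinearMap.sub_apply, LinearMap.comp_apply, hq0, map_zero, sub_zero,
      LinearMap.id_apply, LinearMap.zero_apply] at this
    simpa using this
  rwa [le_antisymm hKU hUK]

theorem splits_of_torsion (hY : IsBrick Y) (hYR : RightPerp R Y.carrier)
    (hYL : LeftPerp L Y.carrier) (hRL : ∀ Z ∈ R, LeftPerp L Z.carrier)
    (h1 : ∀ M : FDModule Λ, LeftPerp L M.carrier → RightPerp (insert Y R) M.carrier →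
      Subsingleton M.carrier)
    (h2 : ∀ M : FDModule Λ, LeftPerp (insert Y L) M.carrier → RightPerp R M.carrier →
      Subsingleton M.carrier)
    (hsplit : ∀ (M : FDModule Λ) (f : Y.carrier →ₗ[Λ] M.carrier)
      (g : M.carrier →ₗ[Λ] X.carrier), IsShortExact f g → SESSplits g)
    (n : ℕ∞) : ∀ (N E : Type) [AddCommGroup N] [Module Λ N] [Module.Finite Λ N]
      [AddCommGroup E] [Module Λ E] [Module.Finite Λ E] (f : N →ₗ[Λ] E)
      (g : E →ₗ[Λ] X.carrier), Module.length Λ N = n → LeftPerp L N → RightPerp R N →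
      IsShortExact f g → SESSplits g := by
  induction n using WellFoundedLT.induction with
  | ind n ih =>
  intro N E _ _ _ _ _ _ f g hn hNL hNR ⟨hf, hfg, hg⟩
  rcases subsingleton_or_nontrivial N with hN | hN
  · have hinj : Function.Injective g := by
      rw [← LinearMap.ker_eq_bot, ← hfg, LinearMap.range_eq_bot]
      ext x
      rw [Subsingleton.elim x 0]
      simp
    let e := LinearEquiv.ofBijective g ⟨hinj, hg⟩
    exact ⟨e.symm.toLinearMap, LinearMap.ext fun x => e.apply_symm_apply x⟩
  obtain ⟨p, hps, hpL⟩ := exists_surjective_to_brick hY hYR hYL hRL h1 h2 N hNL hNR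
  set D := (LinearMap.ker p).map f with hD
  have hDg : D ≤ LinearMap.ker g := by
    rw [← hfg]
    exact LinearMap.map_le_range
  obtain ⟨f', hf'⟩ := exists_comp_eq_of_ker_le hps (f := D.mkQ.comp f) (by
    intro x hx
    have : f x ∈ D := ⟨x, hx, rfl⟩
    simpa using this)
  have hf'p : ∀ x, f' (p x) = D.mkQ (f x) := fun x => LinearMap.congr_fun hf' x
  obtain ⟨s, hs⟩ := hsplit ⟨E ⧸ D⟩ f' (D.liftQ g hDg) (by
    refine ⟨?_, ?_, ?_⟩
    · rw [injective_iff_map_eq_zero]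
      intro y hy
      obtain ⟨x, rfl⟩ := hps y
      rw [hf'p] at hy
      obtain ⟨x', hx', hxx⟩ : f x ∈ D := by simpa using hy
      rw [← hf hxx]
      exact hx'
    · ext v
      obtain ⟨v, rfl⟩ := D.mkQ_surjective v
      constructor
      · rintro ⟨y, hy⟩
        obtain ⟨x, rfl⟩ := hps y
        rw [← hy, hf'p]
        have : f x ∈ LinearMap.ker g := hfg ▸ ⟨x, rfl⟩
        exact this
      · intro hv
        have : v ∈ LinearMap.range f := hfg ▸ (show g v = 0 from hv)
        obtain ⟨x, rfl⟩ := this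
        exact ⟨p x, hf'p x⟩
    · intro y
      obtain ⟨v, rfl⟩ := hg y
      exact ⟨D.mkQ v, rfl⟩)
  have hs' : ∀ x, D.liftQ g hDg (s x) = x := fun x => LinearMap.congr_fun hs x
  let E' := (LinearMap.range s).comap D.mkQ
  have hDE : ∀ d ∈ D, d ∈ E' := fun d hd => by
    have : D.mkQ d = 0 := by simpa using hd
    simp only [E', Submodule.mem_comap, this, Submodule.zero_mem]
  have hlt : Module.length Λ (LinearMap.ker p) < n := by
    rw [← hn]
    refine Submodule.length_lt fun htop => ?_
    have := hY.1
    obtain ⟨y, hy⟩ := exists_ne (0 : Y.carrier)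
    obtain ⟨x, rfl⟩ := hps y
    exact hy (htop ▸ Submodule.mem_top : x ∈ LinearMap.ker p)
  obtain ⟨t, ht⟩ := ih _ hlt (LinearMap.ker p) E'
    (f.restrict fun x hx => hDE _ ⟨x, hx, rfl⟩) (g.comp E'.subtype) rfl hpL
    (hNR.of_injective (LinearMap.ker p).subtype_injective) (by
    refine ⟨?_, ?_, ?_⟩
    · intro x y hxy
      exact Subtype.ext (hf (congrArg Subtype.val hxy))
    · ext ⟨v, x, hx⟩
      constructor
      · rintro ⟨k, hk⟩
        have hk' : f k = v := congrArg Subtype.val hk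
        change g v = 0
        rw [← hk']
        exact (hfg ▸ ⟨k, rfl⟩ : f k ∈ LinearMap.ker g)
      · intro hv
        have hv' : g v = 0 := hv
        have h0 : x = 0 := by
          rw [← hs' x, hx]
          exact hv'
        have : D.mkQ v = 0 := by rw [← hx, h0, map_zero]
        obtain ⟨k, hk, hkv⟩ : v ∈ D := by simpa using this
        exact ⟨⟨k, hk⟩, Subtype.ext hkv⟩
    · intro x
      obtain ⟨v, hv⟩ := D.mkQ_surjective (s x)
      refine ⟨⟨v, x, hv.symm⟩, ?_⟩
      have := hs' x
      rw [← hv] at this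
      exact this)
  exact ⟨E'.subtype.comp t, ht⟩

theorem subsingleton_of_swapped_perp (hY : IsBrick Y) (hYR : RightPerp R Y.carrier)
    (hYL : LeftPerp (insert X L) Y.carrier) (hRL : ∀ Z ∈ R, LeftPerp (insert X L) Z.carrier)
    (h0 : ∀ M : FDModule Λ, LeftPerp L M.carrier → RightPerp (insert X (insert Y R)) M.carrier →
      Subsingleton M.carrier)
    (h1 : ∀ M : FDModule Λ, LeftPerp (insert X L) M.carrier →
      RightPerp (insert Y R) M.carrier → Subsingleton M.carrier)
    (h2 : ∀ M : FDModule Λ, LeftPerp (insert Y (insert X L)) M.carrier →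
      RightPerp R M.carrier → Subsingleton M.carrier)
    (hsplit : ∀ (M : FDModule Λ) (f : Y.carrier →ₗ[Λ] M.carrier)
      (g : M.carrier →ₗ[Λ] X.carrier), IsShortExact f g → SESSplits g)
    (C : FDModule Λ) (hCL : LeftPerp (insert Y L) C.carrier)
    (hCR : RightPerp (insert X R) C.carrier) : Subsingleton C.carrier := by
  obtain ⟨N, -, hNL, hrad⟩ := exists_torsion_radical (insert X L) (⊤ : Submodule Λ C.carrier)
  have hrad' : ∀ Z : FDModule Λ, LeftPerp (insert X L) Z.carrier →
      ∀ φ : Z.carrier →ₗ[Λ] C.carrier ⧸ N, φ = 0 := fun Z hZ φ =>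
    hrad _ hZ φ (by simp)
  have hNR : RightPerp R N := RightPerp.of_injective
    (fun Z hZ => hCR Z (Set.mem_insert_of_mem _ hZ)) N.subtype_injective
  have hQ : Subsingleton (C.carrier ⧸ N) := by
    refine h0 ⟨C.carrier ⧸ N⟩ (LeftPerp.of_surjective
      (fun Z hZ => hCL Z (Set.mem_insert_of_mem _ hZ)) N.mkQ_surjective) ?_
    rintro Z (rfl | rfl | hZ) φ
    · change Z.carrier →ₗ[Λ] C.carrier ⧸ N at φ
      let E := LinearMap.eqLocus (N.mkQ.comp (LinearMap.fst Λ C.carrier Z.carrier))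
        (φ.comp (LinearMap.snd Λ C.carrier Z.carrier))
      have hE : ∀ v ∈ E, N.mkQ v.1 = φ v.2 := fun v hv => hv
      let f : N →ₗ[Λ] E := ((LinearMap.inl Λ C.carrier Z.carrier).comp N.subtype).codRestrict E
        fun x => by simp [E]
      obtain ⟨s, hs⟩ := splits_of_torsion hY hYR hYL hRL h1 h2 hsplit _ N E f
        ((LinearMap.snd Λ C.carrier Z.carrier).comp E.subtype) rfl hNL hNR (by
        refine ⟨?_, ?_, ?_⟩
        · intro x y hxy
          exact Subtype.ext (congrArg (fun v : E => v.1.1) hxy)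
        · ext ⟨⟨c, z⟩, hv⟩
          constructor
          · rintro ⟨k, hk⟩
            exact (congrArg (fun v : E => v.1.2) hk).symm
          · intro hz
            have hz' : z = 0 := hz
            subst hz'
            have : N.mkQ c = 0 := by simpa using hE _ hv
            have hc : c ∈ N := by simpa using this
            exact ⟨⟨c, hc⟩, rfl⟩
        · intro z
          obtain ⟨c, hc⟩ := N.mkQ_surjective (φ z)
          exact ⟨⟨(c, z), hc⟩, rfl⟩)
      have hzero := hCR Z (Set.mem_insert _ _)
        ((LinearMap.fst Λ C.carrier Z.carrier).comp (E.subtype.comp s))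
      refine LinearMap.ext fun z => ?_
      have hz1 : (s z).1.1 = 0 := LinearMap.congr_fun hzero z
      have hz2 : (s z).1.2 = z := LinearMap.congr_fun hs z
      have := hE _ (s z).2
      rw [hz1, hz2, map_zero] at this
      exact this.symm
    · exact hrad' Z hYL φ
    · exact hrad' Z (hRL Z hZ) φ
  have hNtop : N = ⊤ := Submodule.Quotient.subsingleton_iff.1 hQ
  subst hNtop
  refine h2 C ?_ fun Z hZ => hCR Z (Set.mem_insert_of_mem _ hZ)
  rintro Z (rfl | hZ)
  · exact hCL _ (Set.mem_insert _ _)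
  · exact (hNL.of_surjective (p := Submodule.topEquiv.toLinearMap)
      Submodule.topEquiv.surjective) Z hZ

end Core

section Extension

variable {Λ : Type} [Ring Λ] {X Y M : FDModule Λ} {f : Y.carrier →ₗ[Λ] M.carrier}
  {g : M.carrier →ₗ[Λ] X.carrier}

theorem IsShortExact.apply_apply_eq_zero (h : IsShortExact f g) (y : Y.carrier) :
    g (f y) = 0 :=
  (h.2.1 ▸ ⟨y, rfl⟩ : f y ∈ LinearMap.ker g)

theorem IsShortExact.splits_of_bijective_comp_s2 (h : IsShortExact f g)
    (ρ : M.carrier →ₗ[Λ] Y.carrier) (hb : Function.Bijective (ρ.comp f)) : SESSplits g := by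
  let e := LinearEquiv.ofBijective (ρ.comp f) hb
  have he : ∀ y, e.symm (ρ (f y)) = y := fun y => e.symm_apply_apply y
  obtain ⟨s, hs⟩ := exists_comp_eq_of_ker_le h.2.2
    (f := LinearMap.id - f.comp (e.symm.toLinearMap.comp ρ)) (by
      rw [← h.2.1]
      rintro _ ⟨y, rfl⟩
      simp [he])
  refine ⟨s, LinearMap.ext fun x => ?_⟩
  obtain ⟨m, rfl⟩ := h.2.2 x
  have := LinearMap.congr_fun hs m
  simp only [LinearMap.comp_apply, LinearMap.sub_apply, LinearMap.id_apply] at this ⊢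
  rw [this, map_sub, h.apply_apply_eq_zero, sub_zero]

theorem IsShortExact.noHom_to_left (h : IsShortExact f g) (hns : ¬ SESSplits g)
    (hY : IsBrick Y) (hXY : NoHom X Y) : NoHom M Y := by
  intro a
  rcases hY.2 (a.comp f) with h0 | hb
  · obtain ⟨a', rfl⟩ := exists_comp_eq_of_ker_le h.2.2 (f := a) (by
      rw [← h.2.1]
      rintro _ ⟨y, rfl⟩
      exact LinearMap.congr_fun h0 y)
    rw [hXY a', LinearMap.zero_comp]
  · exact absurd (h.splits_of_bijective_comp_s2 a hb) hns

theorem IsShortExact.noHom_from_right (h : IsShortExact f g) (hns : ¬ SESSplits g)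
    (hX : IsBrick X) (hXY : NoHom X Y) : NoHom X M := by
  intro b
  rcases hX.2 (g.comp b) with h0 | hb
  · obtain ⟨b', rfl⟩ := exists_comp_eq_of_range_le h.1 (h := b) (by
      rw [h.2.1]
      rintro _ ⟨x, rfl⟩
      exact LinearMap.congr_fun h0 x)
    rw [hXY b', LinearMap.comp_zero]
  · let e := LinearEquiv.ofBijective (g.comp b) hb
    exact absurd ⟨b.comp e.symm.toLinearMap, LinearMap.ext fun x => e.apply_symm_apply x⟩ hns

theorem IsShortExact.isBrick_of_not_splits (h : IsShortExact f g) (hns : ¬ SESSplits g)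
    (hX : IsBrick X) (hY : IsBrick Y) (hXY : NoHom X Y) (hYX : NoHom Y X) : IsBrick M := by
  have := hX.1
  refine ⟨h.2.2.nontrivial, fun φ => ?_⟩
  obtain ⟨φY, hφY⟩ := exists_comp_eq_of_range_le h.1 (h := φ.comp f) (by
    rw [h.2.1]
    rintro _ ⟨y, rfl⟩
    exact LinearMap.congr_fun (hYX (g.comp (φ.comp f))) y)
  obtain ⟨φX, hφX⟩ := exists_comp_eq_of_ker_le h.2.2 (f := g.comp φ) (by
    rw [← h.2.1]
    rintro _ ⟨y, rfl⟩
    exact LinearMap.congr_fun (hYX (g.comp (φ.comp f))) y)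
  rcases hY.2 φY with hY0 | hYb
  · left
    obtain ⟨b, rfl⟩ := exists_comp_eq_of_ker_le h.2.2 (f := φ) (by
      rw [← h.2.1]
      rintro _ ⟨y, rfl⟩
      have := LinearMap.congr_fun hφY y
      simpa [hY0] using this.symm)
    rw [h.noHom_from_right hns hX hXY b, LinearMap.zero_comp]
  rcases hX.2 φX with hX0 | hXb
  · left
    obtain ⟨a, rfl⟩ := exists_comp_eq_of_range_le h.1 (h := φ) (by
      rw [h.2.1]
      rintro _ ⟨m, rfl⟩
      have := LinearMap.congr_fun hφX m
      simpa [hX0] using this.symm)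
    rw [h.noHom_to_left hns hY hXY a, LinearMap.comp_zero]
  right
  have hφY' : ∀ y, f (φY y) = φ (f y) := fun y => LinearMap.congr_fun hφY y
  have hφX' : ∀ m, φX (g m) = g (φ m) := fun m => LinearMap.congr_fun hφX m
  have hker : ∀ m, g m = 0 → ∃ y, f y = m := fun m hm =>
    (h.2.1.symm ▸ hm : m ∈ LinearMap.range f)
  constructor
  · rw [injective_iff_map_eq_zero]
    intro m hm
    have hgm : g m = 0 := hXb.1 (by rw [hφX', hm, map_zero, map_zero])
    obtain ⟨y, rfl⟩ := hker m hgm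
    have hy : y = 0 := hYb.1 (h.1 (by rw [hφY', hm, map_zero, map_zero]))
    rw [hy, map_zero]
  · intro m
    obtain ⟨x, hx⟩ := hXb.2 (g m)
    obtain ⟨m', rfl⟩ := h.2.2 x
    obtain ⟨y, hy⟩ := hker (m - φ m') (by rw [map_sub, ← hφX', hx, sub_self])
    obtain ⟨y', rfl⟩ := hYb.2 y
    exact ⟨f y' + m', by rw [map_add, ← hφY', hy, sub_add_cancel]⟩

end Extension

theorem IsMaximalBHO.subsingleton {Λ : Type} [Ring Λ] [IsArtinianRing Λ] {r : ℕ}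
    {B : Fin r → FDModule Λ} (h : IsMaximalBHO B) {k : ℕ} (hk : k ≤ r) (M : FDModule Λ)
    (hl : ∀ j : Fin r, (j : ℕ) < k → NoHom M (B j))
    (hr : ∀ j : Fin r, k ≤ (j : ℕ) → NoHom (B j) M) : Subsingleton M.carrier := by
  by_contra hn
  have : Nontrivial M.carrier := not_subsingleton_iff_nontrivial.1 hn
  obtain ⟨C, a, p, hC, ha, hp⟩ := exists_brick_submodule_quotient (Λ := Λ) M.carrier
  refine h.2.2 C hC k hk ⟨fun j hj => ?_, fun j hj => ?_⟩
  · exact LeftPerp.of_surjective (S := {B j}) (by rintro _ rfl; exact hl j hj) hp _ rfl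
  · exact RightPerp.of_injective (S := {B j}) (by rintro _ rfl; exact hr j hj) ha _ rfl

/-- the sequence obtained by swapping the adjacent entries `B i` and
`B (i+1)` of a maximal backwards Hom-orthogonal sequence of bricks is again a
maximal backwards Hom-orthogonal sequence of bricks if and only if
`Hom(B i, B (i+1)) = 0` and every short exact sequence
`0 → B (i+1) → M → B i → 0` splits. -/
theorem statement_2 (K : Type) [Field K] (Λ : Type) [Ring Λ] [Algebra K Λ]
    [FiniteDimensional K Λ]
    {r : ℕ} (B : Fin r → FDModule Λ) (hmax : IsMaximalBHO B)
    (i : Fin r) (hi : (i : ℕ) + 1 < r) :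
    IsMaximalBHO (fun k => B (Equiv.swap i ⟨(i : ℕ) + 1, hi⟩ k)) ↔
      (NoHom (B i) (B ⟨(i : ℕ) + 1, hi⟩) ∧
        ∀ (M : FDModule Λ) (f : (B ⟨(i : ℕ) + 1, hi⟩).carrier →ₗ[Λ] M.carrier)
          (g : M.carrier →ₗ[Λ] (B i).carrier),
          IsShortExact f g → SESSplits g) := by
  have : IsArtinianRing Λ := IsArtinianRing.of_finite K Λ
  have hr : (i : ℕ) < r := i.2
  set i' : Fin r := ⟨(i : ℕ) + 1, hi⟩ with hi'
  have hval : ∀ j : Fin r, j = i ∨ j = i' ∨ (j : ℕ) < i ∨ (i : ℕ) + 1 < j := by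
    intro j
    simp only [Fin.ext_iff, hi']
    omega
  have hσl : Equiv.swap i i' i = i' := Equiv.swap_apply_left i i'
  have hσr : Equiv.swap i i' i' = i := Equiv.swap_apply_right i i'
  have hii' : i < i' := by simp [Fin.lt_def, hi']
  have hout : ∀ j : Fin r, (j : ℕ) < i ∨ (i : ℕ) + 1 < j → Equiv.swap i i' j = j := by
    intro j hj
    apply Equiv.swap_apply_of_ne_of_ne <;> simp only [ne_eq, Fin.ext_iff, hi'] <;> omega
  have hYX : NoHom (B i') (B i) := hmax.2.1 i i' hii'
  constructor
  · intro hswap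
    have hXY : NoHom (B i) (B i') := by
      have := hswap.2.1 i i' hii'
      simpa only [hσl, hσr] using this
    refine ⟨hXY, fun M f g hfg => ?_⟩
    by_contra hns
    refine hswap.2.2 M (hfg.isBrick_of_not_splits hns (hmax.1 i) (hmax.1 i') hXY hYX)
      ((i : ℕ) + 1) hi.le ⟨fun j hj => ?_, fun j hj => ?_⟩
    · rcases hval j with rfl | rfl | h | h
      · simpa only [hσl] using hfg.noHom_to_left hns (hmax.1 i') hXY
      · simp [hi'] at hj
      · beta_reduce
        rw [hout j (Or.inl h)]
        exact LeftPerp.of_extension (S := {B j}) (a := f) (p := g)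
          (by rintro _ rfl; exact hmax.2.1 j i' (Fin.lt_def.2 (h.trans hii')))
          (by rintro _ rfl; exact hmax.2.1 j i h) hfg.2.2 hfg.2.1.ge _ rfl
      · omega
    · rcases hval j with rfl | rfl | h | h
      · omega
      · simpa only [hσr] using hfg.noHom_from_right hns (hmax.1 i) hXY
      · omega
      · beta_reduce
        rw [hout j (Or.inr h)]
        exact RightPerp.of_extension (S := {B j}) (a := f) (p := g)
          (by rintro _ rfl; exact hmax.2.1 i' j h)
          (by rintro _ rfl; exact hmax.2.1 i j (Fin.lt_def.2 (by omega))) hfg.1 hfg.2.1.ge _ rfl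
  · rintro ⟨hXY, hsplit⟩
    refine ⟨fun j => hmax.1 _, fun a b hab => ?_, fun C hC k hk ⟨hl, hrr⟩ => ?_⟩
    · have hab' : (a : ℕ) < b := hab
      beta_reduce
      rcases hval a with rfl | rfl | ha | ha
      · rcases hval b with rfl | rfl | hb | hb
        · omega
        · simpa only [hσl, hσr] using hXY
        · omega
        · rw [hσl, hout b (Or.inr hb)]
          exact hmax.2.1 i' b hb
      · rcases hval b with rfl | rfl | hb | hb
        · exact absurd (hab.trans hii') (lt_irrefl _)
        · omega
        · exact absurd (hab.trans (Fin.lt_def.2 hb)) (not_lt.2 hii'.le)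
        · rw [hσr, hout b (Or.inr hb)]
          exact hmax.2.1 _ b (Fin.lt_def.2 (by omega))
      · rcases hval b with rfl | rfl | hb | hb
        · rw [hσl, hout a (Or.inl ha)]
          exact hmax.2.1 a i' (hab.trans hii')
        · rw [hσr, hout a (Or.inl ha)]
          exact hmax.2.1 a i ha
        · rw [hout a (Or.inl ha), hout b (Or.inl hb)]
          exact hmax.2.1 a b hab
        · rw [hout a (Or.inl ha), hout b (Or.inr hb)]
          exact hmax.2.1 a b hab
      · rcases hval b with rfl | rfl | hb | hb
        · omega
        · exact absurd (hab.trans (Fin.lt_def.2 ha : i' < a)) (lt_irrefl _)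
        · omega
        · rw [hout a (Or.inr ha), hout b (Or.inr hb)]
          exact hmax.2.1 a b hab
    have hl' : ∀ j : Fin r, (Equiv.swap i i' j : ℕ) < k → NoHom C (B j) := fun j hj => by
      simpa only [Equiv.swap_apply_self] using hl _ hj
    have hrr' : ∀ j : Fin r, k ≤ (Equiv.swap i i' j : ℕ) → NoHom (B j) C := fun j hj => by
      simpa only [Equiv.swap_apply_self] using hrr _ hj
    have hv' : (i' : ℕ) = i + 1 := rfl
    rcases eq_or_ne k ((i : ℕ) + 1) with rfl | hkne
    · have := hC.1
      refine not_subsingleton C.carrier ?_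
      refine subsingleton_of_swapped_perp (X := B i) (Y := B i')
        (L := {Z | ∃ j : Fin r, (j : ℕ) < i ∧ B j = Z})
        (R := {Z | ∃ j : Fin r, (i : ℕ) + 1 < j ∧ B j = Z}) (hmax.1 i')
        ?_ ?_ ?_ ?_ ?_ ?_ hsplit C ?_ ?_
      · rintro _ ⟨j, hj, rfl⟩
        exact hmax.2.1 i' j hj
      · rintro _ (rfl | ⟨j, hj, rfl⟩)
        · exact hYX
        · exact hmax.2.1 j i' (Fin.lt_def.2 (by omega))
      · rintro _ ⟨j, hj, rfl⟩ _ (rfl | ⟨j', hj', rfl⟩)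
        · exact hmax.2.1 i j (Fin.lt_def.2 (by omega))
        · exact hmax.2.1 j' j (Fin.lt_def.2 (by omega))
      · intro M hM hM'
        refine hmax.subsingleton (k := i) hr.le M (fun j hj => ?_) (fun j hj => ?_)
        · exact hM _ ⟨j, hj, rfl⟩
        · rcases hval j with rfl | rfl | h | h
          · exact hM' _ (Or.inl rfl)
          · exact hM' _ (Or.inr (Or.inl rfl))
          · omega
          · exact hM' _ (Or.inr (Or.inr ⟨j, h, rfl⟩))
      · intro M hM hM'
        refine hmax.subsingleton (k := i + 1) hi.le M (fun j hj => ?_) (fun j hj => ?_)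
        · rcases hval j with rfl | rfl | h | h
          · exact hM _ (Or.inl rfl)
          · omega
          · exact hM _ (Or.inr ⟨j, h, rfl⟩)
          · omega
        · rcases hval j with rfl | rfl | h | h
          · omega
          · exact hM' _ (Or.inl rfl)
          · omega
          · exact hM' _ (Or.inr ⟨j, h, rfl⟩)
      · intro M hM hM'
        refine hmax.subsingleton (k := i + 2) hi M (fun j hj => ?_) (fun j hj => ?_)
        · rcases hval j with rfl | rfl | h | h
          · exact hM _ (Or.inr (Or.inl rfl))
          · exact hM _ (Or.inl rfl)
          · exact hM _ (Or.inr (Or.inr ⟨j, h, rfl⟩))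
          · omega
        · exact hM' _ ⟨j, hj, rfl⟩
      · rintro _ (rfl | ⟨j, hj, rfl⟩)
        · exact hl' i' (by rw [hσr]; omega)
        · exact hl' j (by rw [hout j (Or.inl hj)]; omega)
      · rintro _ (rfl | ⟨j, hj, rfl⟩)
        · exact hrr' i (by rw [hσl])
        · exact hrr' j (by rw [hout j (Or.inr hj)]; omega)
    · refine hmax.2.2 C hC k hk ⟨fun j hj => hl' j ?_, fun j hj => hrr' j ?_⟩ <;>
      · rcases hval j with rfl | rfl | h | h
        · rw [hσl]
          omega
        · rw [hσr]
          omega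
        · rw [hout j (Or.inl h)]
          omega
        · rw [hout j (Or.inr h)]
          omega
end

section
/- Let B_1, …, B_r (with r ≥ 1) be a maximal backwards Hom-orthogonal sequence of bricks over Λ. Then both B_1 and B_r are simple Λ-modules. -/
theorem isSimpleModule_of_comp_ne_zero {Λ : Type} [Ring Λ] {M : FDModule Λ} (hM : IsBrick M)
    {S : Type} [AddCommGroup S] [Module Λ S] [IsSimpleModule Λ S]
    {f : M.carrier →ₗ[Λ] S} (hf : f ≠ 0) {g : S →ₗ[Λ] M.carrier} (hg : g ≠ 0) :
    IsSimpleModule Λ M.carrier := by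
  have hfs : Function.Surjective f := LinearMap.surjective_of_ne_zero hf
  have hgi : Function.Injective g := LinearMap.injective_of_ne_zero hg
  have hgf : g ∘ₗ f ≠ 0 := fun h => hf <| by
    ext x
    exact hgi (by simpa using LinearMap.congr_fun h x)
  have hgs : Function.Surjective g := by
    have h := ((hM.2 (g ∘ₗ f)).resolve_left hgf).2
    rw [LinearMap.coe_comp] at h
    exact h.of_comp
  exact IsSimpleModule.congr (LinearEquiv.ofBijective g ⟨hgi, hgs⟩).symm

theorem isBrick_of_isSimpleModule {Λ : Type} [Ring Λ] (M : FDModule Λ)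
    [IsSimpleModule Λ M.carrier] : IsBrick M :=
  ⟨IsSimpleModule.nontrivial Λ M.carrier, fun f => f.bijective_or_eq_zero.symm⟩

theorem IsMaximalBHO.exists_hom_ne_zero_to {Λ : Type} [Ring Λ] {r : ℕ} {B : Fin r → FDModule Λ}
    (hB : IsMaximalBHO B) {C : FDModule Λ} (hC : IsBrick C) :
    ∃ j, ∃ f : (B j).carrier →ₗ[Λ] C.carrier, f ≠ 0 := by
  by_contra! h
  exact hB.2.2 C hC 0 (Nat.zero_le r)
    ⟨fun i hi => absurd hi (Nat.not_lt_zero _), fun j _ => h j⟩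

theorem IsMaximalBHO.exists_hom_ne_zero_from {Λ : Type} [Ring Λ] {r : ℕ} {B : Fin r → FDModule Λ}
    (hB : IsMaximalBHO B) {C : FDModule Λ} (hC : IsBrick C) :
    ∃ i, ∃ f : C.carrier →ₗ[Λ] (B i).carrier, f ≠ 0 := by
  by_contra! h
  exact hB.2.2 C hC r le_rfl
    ⟨fun i _ => h i, fun j hj => absurd j.2 (Nat.not_lt.2 hj)⟩

/-- A simple submodule of the first brick is also a quotient of it, hence equal to it. -/
theorem IsMaximalBHO.isSimpleModule_of_forall_le {Λ : Type} [Ring Λ] [IsArtinianRing Λ]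
    {r : ℕ} {B : Fin r → FDModule Λ} (hB : IsMaximalBHO B) (i : Fin r) (hi : ∀ j, i ≤ j) :
    IsSimpleModule Λ (B i).carrier := by
  have := (hB.1 i).1
  obtain ⟨S, hS⟩ := IsAtomic.exists_atom (Submodule Λ (B i).carrier)
  have : IsSimpleModule Λ S := isSimpleModule_iff_isAtom.2 hS
  have hS' : S.subtype ≠ 0 := fun h => hS.1 (by simpa using congrArg LinearMap.range h)
  obtain ⟨j, f, hf⟩ := hB.exists_hom_ne_zero_to (isBrick_of_isSimpleModule (FDModule.mk S))
  obtain rfl | hij := (hi j).eq_or_lt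
  · exact isSimpleModule_of_comp_ne_zero (hB.1 i) (S := S) hf hS'
  · refine absurd ?_ hf
    ext x
    exact LinearMap.congr_fun (hB.2.1 i j hij (S.subtype ∘ₗ f)) x

/-- A simple quotient of the last brick also embeds into it, hence is equal to it. -/
theorem IsMaximalBHO.isSimpleModule_of_forall_ge {Λ : Type} [Ring Λ]
    {r : ℕ} {B : Fin r → FDModule Λ} (hB : IsMaximalBHO B) (j : Fin r) (hj : ∀ i, i ≤ j) :
    IsSimpleModule Λ (B j).carrier := by
  have := (hB.1 j).1
  obtain ⟨N, hN⟩ := IsCoatomic.exists_coatom (Submodule Λ (B j).carrier)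
  have : IsSimpleModule Λ ((B j).carrier ⧸ N) := isSimpleModule_iff_isCoatom.2 hN
  have hN' : N.mkQ ≠ 0 := fun h => hN.1 (by simpa using congrArg LinearMap.ker h)
  obtain ⟨i, f, hf⟩ :=
    hB.exists_hom_ne_zero_from (isBrick_of_isSimpleModule (FDModule.mk ((B j).carrier ⧸ N)))
  obtain rfl | hij := (hj i).eq_or_lt
  · exact isSimpleModule_of_comp_ne_zero (hB.1 i) hN' hf
  · refine absurd ?_ hf
    ext x
    exact LinearMap.congr_fun (hB.2.1 i j hij (f ∘ₗ N.mkQ)) x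

/-- the first and last entries of a maximal backwards Hom-orthogonal
sequence of bricks are simple modules. -/
theorem statement_4 (K : Type) [Field K] (Λ : Type) [Ring Λ] [Algebra K Λ]
    [FiniteDimensional K Λ]
    {r : ℕ} (hr : 1 ≤ r) (B : Fin r → FDModule Λ) (hmax : IsMaximalBHO B) :
    IsSimpleModule Λ (B ⟨0, by omega⟩).carrier ∧
      IsSimpleModule Λ (B ⟨r - 1, by omega⟩).carrier := by
  have : IsArtinianRing Λ := IsArtinianRing.of_finite K Λ
  exact ⟨hmax.isSimpleModule_of_forall_le _ fun j => Fin.mk_le_of_le_val (Nat.zero_le _),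
    hmax.isSimpleModule_of_forall_ge _ fun i => Fin.le_def.2 (Nat.le_sub_one_of_lt i.2)⟩
end

section
/- Let T and U be torsion classes of Λ-modules with U ⊆ T, and let T = X_0 ⊃ X_1 ⊃ … ⊃ X_m = U be a finite chain of minimal inclusions of torsion classes in which each minimal inclusion X_{k−1} ⊃ X_k is labelled by a brick B_k. Then every module which is relatively simple in the class T ∩ U^⊥ is isomorphic to B_k for some 1 ≤ k ≤ m. -/
/-- The module `M` lies in `Filt(X)`: it has a finite chain of submodules
`⊥ = c 0 ⊆ c 1 ⊆ … ⊆ c t = ⊤` all of whose subquotients are isomorphic to `X`. -/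
def InFilt {Λ : Type} [Ring Λ] (X : FDModule Λ) (M : Type) [AddCommGroup M]
    [Module Λ M] : Prop :=
  ∃ (t : ℕ) (c : Fin (t + 1) → Submodule Λ M),
    Monotone c ∧ c 0 = ⊥ ∧ c (Fin.last t) = ⊤ ∧
      ∀ k : Fin t,
        Nonempty ((↥(c k.succ) ⧸ Submodule.comap (c k.succ).subtype (c k.castSucc))
          ≃ₗ[Λ] X.carrier)

/-- A torsion class: a class of (finite-dimensional) modules closed under
isomorphisms, containing `0`, and closed under quotient modules and extensions. -/
def IsTorsionClass {Λ : Type} [Ring Λ] (T : Set (FDModule Λ)) : Prop :=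
  (∀ M N : FDModule Λ, M ∈ T → Nonempty (M.carrier ≃ₗ[Λ] N.carrier) → N ∈ T) ∧
  (∀ M : FDModule Λ, Subsingleton M.carrier → M ∈ T) ∧
  (∀ M N : FDModule Λ, M ∈ T →
      (∃ f : M.carrier →ₗ[Λ] N.carrier, Function.Surjective f) → N ∈ T) ∧
  (∀ L M N : FDModule Λ, L ∈ T → N ∈ T →
      ∀ (f : L.carrier →ₗ[Λ] M.carrier) (g : M.carrier →ₗ[Λ] N.carrier),
        IsShortExact f g → M ∈ T)

/-- `U ⊂ T` is a minimal inclusion of torsion classes. -/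
def IsMinimalInclusion {Λ : Type} [Ring Λ] (T U : Set (FDModule Λ)) : Prop :=
  IsTorsionClass T ∧ IsTorsionClass U ∧ U ⊂ T ∧
    ∀ V : Set (FDModule Λ), IsTorsionClass V → U ⊆ V → V ⊆ T → V = U ∨ V = T

/-- `U^⊥`: the class of modules admitting no non-zero homomorphism from any member
of `U`. -/
def PerpSet {Λ : Type} [Ring Λ] (U : Set (FDModule Λ)) : Set (FDModule Λ) :=
  {M | ∀ U' ∈ U, ∀ f : U'.carrier →ₗ[Λ] M.carrier, f = 0}

/-- The class of modules filtered by `B`. -/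
def FiltSet {Λ : Type} [Ring Λ] (B : FDModule Λ) : Set (FDModule Λ) :=
  {M | InFilt B M.carrier}

/-- The minimal inclusion `U ⊂ T` is labelled by the brick `B`:
`T ∩ U^⊥ = Filt(B)`. -/
def IsBrickLabel {Λ : Type} [Ring Λ] (T U : Set (FDModule Λ)) (B : FDModule Λ) : Prop :=
  IsBrick B ∧ T ∩ PerpSet U = FiltSet B

/-- `S` is relatively simple in the class `C`: `S` is a non-zero member of `C` and
there is no short exact sequence `0 → A → S → Q → 0` with `A` and `Q` non-zero
members of `C`. -/
def RelativelySimple {Λ : Type} [Ring Λ] (C : Set (FDModule Λ)) (S : FDModule Λ) : Prop :=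
  S ∈ C ∧ Nontrivial S.carrier ∧
    ¬ ∃ (A Q : FDModule Λ) (f : A.carrier →ₗ[Λ] S.carrier) (g : S.carrier →ₗ[Λ] Q.carrier),
        A ∈ C ∧ Q ∈ C ∧ Nontrivial A.carrier ∧ Nontrivial Q.carrier ∧ IsShortExact f g

section TorsionClasses

variable {Λ : Type} [Ring Λ]

theorem mem_perpSet_of_injective {U : Set (FDModule Λ)} {M N : FDModule Λ}
    (hN : N ∈ PerpSet U) (i : M.carrier →ₗ[Λ] N.carrier) (hi : Function.Injective i) :
    M ∈ PerpSet U := by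
  intro U' hU' f
  have h := hN U' hU' (i.comp f)
  ext x
  apply hi
  simpa using LinearMap.congr_fun h x

theorem perpSet_antitone {U V : Set (FDModule Λ)} (h : U ⊆ V) : PerpSet V ⊆ PerpSet U :=
  fun _ hM U' hU' => hM U' (h hU')

/-- A module belongs to the class of modules filtered by it. -/
theorem mem_filtSet_self (B : FDModule Λ) : B ∈ FiltSet B := by
  refine ⟨1, ![⊥, ⊤], ?_, rfl, rfl, ?_⟩
  · intro i j hij
    fin_cases i <;> fin_cases j <;> simp_all
  · intro k
    fin_cases k
    refine ⟨(Submodule.quotEquivOfEqBot _ ?_).trans Submodule.topEquiv⟩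
    exact LinearMap.ker_eq_bot.mpr Subtype.val_injective

variable [IsNoetherianRing Λ]

/-- A submodule of a finitely generated module, as a bundled module. -/
def FDModule.ofSubmodule (M : FDModule Λ) (N : Submodule Λ M.carrier) : FDModule Λ where
  carrier := N

/-- The quotient of a finitely generated module by a submodule, as a bundled module. -/
def FDModule.quotient (M : FDModule Λ) (N : Submodule Λ M.carrier) : FDModule Λ where
  carrier := M.carrier ⧸ N

theorem RelativelySimple.eq_bot_or_eq_top {C : Set (FDModule Λ)} {S : FDModule Λ}
    (hS : RelativelySimple C S) (N : Submodule Λ S.carrier)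
    (hN : S.ofSubmodule N ∈ C) (hQ : S.quotient N ∈ C) : N = ⊥ ∨ N = ⊤ := by
  by_contra! h
  exact hS.2.2 ⟨S.ofSubmodule N, S.quotient N, N.subtype, N.mkQ, hN, hQ,
    Submodule.nontrivial_iff_ne_bot.mpr h.1, Submodule.Quotient.nontrivial_iff.mpr h.2,
    N.injective_subtype, N.range_subtype.trans N.ker_mkQ.symm, N.mkQ_surjective⟩

/-- Every module `M` has a submodule in the torsion class `U` with quotient in `U^⊥`. -/
theorem IsTorsionClass.exists_torsion_submodule {U : Set (FDModule Λ)} (hU : IsTorsionClass U)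
    (M : FDModule Λ) :
    ∃ N : Submodule Λ M.carrier, M.ofSubmodule N ∈ U ∧ M.quotient N ∈ PerpSet U := by
  obtain ⟨_, hzero, hquot, hext⟩ := hU
  obtain ⟨N, hN, hmax⟩ := WellFounded.has_min
    (wellFounded_gt : WellFounded fun A B : Submodule Λ M.carrier => A > B)
    {N | M.ofSubmodule N ∈ U}
    ⟨⊥, hzero _ (inferInstanceAs (Subsingleton (⊥ : Submodule Λ M.carrier)))⟩
  refine ⟨N, hN, fun U' hU' f => ?_⟩
  change U'.carrier →ₗ[Λ] M.carrier ⧸ N at f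
  let P := (LinearMap.range f).comap N.mkQ
  have hNP : N ≤ P := by
    intro x hx
    have hx0 : N.mkQ x = 0 := (Submodule.Quotient.mk_eq_zero N).mpr hx
    change N.mkQ x ∈ LinearMap.range f
    rw [hx0]
    exact zero_mem _
  let g : P →ₗ[Λ] LinearMap.range f := N.mkQ.restrict fun _ hx => hx
  have hg : N.comap P.subtype = LinearMap.ker g := by
    ext x
    rw [LinearMap.mem_ker, Submodule.mem_comap, Subtype.ext_iff]
    exact (Submodule.Quotient.mk_eq_zero N).symm
  have hR : (M.quotient N).ofSubmodule (LinearMap.range f) ∈ U :=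
    hquot U' _ hU' ⟨f.rangeRestrict, f.surjective_rangeRestrict⟩
  have hP : M.ofSubmodule P ∈ U := by
    refine hext (M.ofSubmodule N) _ _ hN hR (Submodule.inclusion hNP) g
      ⟨Submodule.inclusion_injective hNP,
        (Submodule.range_inclusion N P hNP).trans hg, ?_⟩
    rintro ⟨y, hy⟩
    obtain ⟨x, rfl⟩ := N.mkQ_surjective y
    exact ⟨⟨x, hy⟩, rfl⟩
  have hPN : P = N := (hNP.eq_of_not_lt (hmax P hP)).symm
  ext u
  obtain ⟨x, hx⟩ := N.mkQ_surjective (f u)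
  have hxP : x ∈ P := ⟨u, hx.symm⟩
  rw [hPN] at hxP
  exact hx.symm.trans ((Submodule.Quotient.mk_eq_zero N).mpr hxP)

/-- If a torsion class contains `X`, it contains every term of a chain of submodules
starting at `⊥` with subquotients isomorphic to `X`. -/
theorem IsTorsionClass.mem_of_chain {T : Set (FDModule Λ)} (hT : IsTorsionClass T)
    {X M : FDModule Λ} (hX : X ∈ T) {t : ℕ} {c : Fin (t + 1) → Submodule Λ M.carrier}
    (hc : Monotone c) (h0 : c 0 = ⊥)
    (hiso : ∀ k : Fin t,
      Nonempty ((↥(c k.succ) ⧸ Submodule.comap (c k.succ).subtype (c k.castSucc))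
        ≃ₗ[Λ] X.carrier)) (j : Fin (t + 1)) :
    M.ofSubmodule (c j) ∈ T := by
  obtain ⟨_, hzero, _, hext⟩ := hT
  induction j using Fin.induction with
  | zero =>
    rw [h0]
    exact hzero _ (inferInstanceAs (Subsingleton (⊥ : Submodule Λ M.carrier)))
  | succ k ih =>
    obtain ⟨e⟩ := hiso k
    have hle : c k.castSucc ≤ c k.succ := hc (Fin.castSucc_lt_succ (i := k)).le
    refine hext _ (M.ofSubmodule (c k.succ)) X ih hX (Submodule.inclusion hle)
      (e.toLinearMap.comp (Submodule.mkQ _)) ⟨Submodule.inclusion_injective hle, ?_, ?_⟩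
    · exact (Submodule.range_inclusion _ _ hle).trans
        ((Submodule.ker_mkQ _).symm.trans (LinearEquiv.ker_comp e _).symm)
    · exact e.surjective.comp (Submodule.mkQ_surjective _)

/-- If `S` is relatively simple in `C` and filtered by a non-zero module `B` of the torsion class
`T`, then `S ≅ B`, provided `C` contains `B` and all submodules of `S` lying in `T`. -/
theorem RelativelySimple.nonempty_equiv_of_mem_filtSet {C T : Set (FDModule Λ)}
    {S B : FDModule Λ} (hS : RelativelySimple C S) (hT : IsTorsionClass T)
    (hBT : B ∈ T) (hB : Nontrivial B.carrier) (hSB : S ∈ FiltSet B)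
    (hsub : ∀ N : Submodule Λ S.carrier, S.ofSubmodule N ∈ T → S.ofSubmodule N ∈ C)
    (hquot : ∀ Q : FDModule Λ, Nonempty (Q.carrier ≃ₗ[Λ] B.carrier) → Q ∈ C) :
    Nonempty (S.carrier ≃ₗ[Λ] B.carrier) := by
  obtain ⟨t, c, hc, h0, h1, hiso⟩ := hSB
  have := hS.2.1
  cases t with
  | zero => exact absurd (h0.symm.trans h1) bot_ne_top
  | succ t =>
    obtain ⟨e⟩ := hiso (Fin.last t)
    have hmem := hT.mem_of_chain hBT hc h0 hiso (Fin.last t).castSucc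
    generalize c (Fin.last t).castSucc = N at e hmem
    rw [Fin.succ_last, h1] at e
    have e' : (S.carrier ⧸ N) ≃ₗ[Λ] B.carrier :=
      (Submodule.Quotient.equiv _ _ Submodule.topEquiv (by
        ext x; simp)).symm.trans e
    rcases hS.eq_bot_or_eq_top N (hsub N hmem) (hquot _ ⟨e'⟩) with h | h
    · exact ⟨(Submodule.quotEquivOfEqBot N h).symm.trans e'⟩
    · have := Submodule.Quotient.subsingleton_iff.mpr h
      exact absurd e'.symm.toEquiv.subsingleton (not_subsingleton _)

end TorsionClasses

/-- given a finite chain of brick-labelled minimal inclusions of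
torsion classes from `T = X 0` down to `U = X m`, every module which is
relatively simple in `T ∩ U^⊥` is isomorphic to one of the brick labels. -/
theorem statement_5 (K : Type) [Field K] (Λ : Type) [Ring Λ] [Algebra K Λ]
    [FiniteDimensional K Λ]
    {m : ℕ} (X : Fin (m + 1) → Set (FDModule Λ)) (B : Fin m → FDModule Λ)
    (hchain : ∀ k : Fin m, IsMinimalInclusion (X k.castSucc) (X k.succ))
    (hlabel : ∀ k : Fin m, IsBrickLabel (X k.castSucc) (X k.succ) (B k))
    (S : FDModule Λ)
    (hS : RelativelySimple (X 0 ∩ PerpSet (X (Fin.last m))) S) :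
    ∃ k : Fin m, Nonempty (S.carrier ≃ₗ[Λ] (B k).carrier) := by
  have : IsNoetherianRing Λ := isNoetherian_of_tower K inferInstance
  have hanti : Antitone X := Fin.antitone_iff_succ_le.mpr fun k => (hchain k).2.2.1.subset
  obtain ⟨hS0, hSm⟩ := hS.1
  have hSnt := hS.2.1
  have hSlast : S ∉ X (Fin.last m) := fun h => by
    obtain ⟨x, hx⟩ := exists_ne (0 : S.carrier)
    exact hx (LinearMap.congr_fun (hSm S h LinearMap.id) x)
  obtain ⟨k, hk, hk'⟩ : ∃ k : Fin m, S ∈ X k.castSucc ∧ S ∉ X k.succ := by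
    by_contra! h
    exact hSlast (Fin.induction (motive := fun j => S ∈ X j) hS0 h (Fin.last m))
  refine ⟨k, ?_⟩
  obtain ⟨hT, hU, -, -⟩ := hchain k
  obtain ⟨⟨hB, -⟩, hfilt⟩ := hlabel k
  have hperp := perpSet_antitone (hanti (Fin.le_last k.succ))
  have hsub : ∀ N : Submodule Λ S.carrier, S.ofSubmodule N ∈ X k.castSucc →
      S.ofSubmodule N ∈ X 0 ∩ PerpSet (X (Fin.last m)) := fun N hN =>
    ⟨hanti (Fin.zero_le _) hN, mem_perpSet_of_injective hSm N.subtype N.injective_subtype⟩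
  have hBmem : B k ∈ X k.castSucc ∩ PerpSet (X k.succ) := hfilt ▸ mem_filtSet_self (B k)
  have hSfilt : S ∈ FiltSet (B k) := by
    obtain ⟨N, hN, hQ⟩ := hU.exists_torsion_submodule S
    have hQT : S.quotient N ∈ X k.castSucc := hT.2.2.1 S _ hk ⟨N.mkQ, N.mkQ_surjective⟩
    rcases hS.eq_bot_or_eq_top N (hsub N (hanti (Fin.castSucc_lt_succ (i := k)).le hN))
      ⟨hanti (Fin.zero_le _) hQT, hperp hQ⟩ with h | h
    · rw [← hfilt]
      exact ⟨hk, mem_perpSet_of_injective hQ N.mkQ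
        (LinearMap.ker_eq_bot.mp (N.ker_mkQ.trans h))⟩
    · exact absurd (hU.1 _ S hN ⟨LinearEquiv.ofTop N h⟩) hk'
  exact hS.nonempty_equiv_of_mem_filtSet hT hBmem.1 hB hSfilt hsub fun Q ⟨e⟩ =>
    ⟨hanti (Fin.zero_le _) (hT.1 _ _ hBmem.1 ⟨e.symm⟩),
      mem_perpSet_of_injective (hperp hBmem.2) e.toLinearMap e.injective⟩
end

section
/- Let Λ be a Nakayama algebra, M an indecomposable Λ-module, and B_1, …, B_s pairwise Hom-orthogonal bricks over Λ (i.e. Hom_Λ(B_i, B_j) = 0 for all i ≠ j). Then any two finite chains of submodules 0 = M_0 ⊂ M_1 ⊂ … ⊂ M_t = M in which every factor M_k/M_{k−1} is isomorphic to one of B_1, …, B_s are equal as chains of submodules of M. -/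
/-- A module is uniserial if its submodules are totally ordered by inclusion. -/
def IsUniserialModule (Λ : Type) [Ring Λ] (M : Type) [AddCommGroup M] [Module Λ M] : Prop :=
  ∀ N₁ N₂ : Submodule Λ M, N₁ ≤ N₂ ∨ N₂ ≤ N₁

/-- A module is indecomposable if it is non-zero and is not the direct sum of two
non-zero submodules. -/
def IsIndecomposableModule (Λ : Type) [Ring Λ] (M : Type) [AddCommGroup M]
    [Module Λ M] : Prop :=
  Nontrivial M ∧ ∀ N₁ N₂ : Submodule Λ M, IsCompl N₁ N₂ → N₁ = ⊥ ∨ N₂ = ⊥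

/-- `Λ` is a Nakayama algebra: every finite-dimensional indecomposable `Λ`-module
is uniserial. -/
def IsNakayama (Λ : Type) [Ring Λ] : Prop :=
  ∀ M : FDModule Λ, IsIndecomposableModule Λ M.carrier → IsUniserialModule Λ M.carrier

/-- If `N < A ≤ C` and both `A ⧸ N` and `C ⧸ N` are isomorphic to members of a family of
pairwise Hom-orthogonal bricks, then `A = C`. -/
theorem eq_of_le_of_quotient_equiv_brick {Λ : Type} [Ring Λ] {M : Type} [AddCommGroup M]
    [Module Λ M] {ι : Type*} {B : ι → FDModule Λ} (hB : ∀ i, IsBrick (B i))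
    (horth : ∀ i j, i ≠ j → NoHom (B i) (B j)) {N A C : Submodule Λ M}
    (hNA : N < A) (hAC : A ≤ C)
    (hA : ∃ i, Nonempty ((A ⧸ N.comap A.subtype) ≃ₗ[Λ] (B i).carrier))
    (hC : ∃ i, Nonempty ((C ⧸ N.comap C.subtype) ≃ₗ[Λ] (B i).carrier)) :
    A = C := by
  obtain ⟨i, ⟨e⟩⟩ := hA
  obtain ⟨j, ⟨e'⟩⟩ := hC
  let φ : (A ⧸ N.comap A.subtype) →ₗ[Λ] (C ⧸ N.comap C.subtype) :=
    Submodule.mapQ _ _ (Submodule.inclusion hAC) fun _ hx => hx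
  let f : (B i).carrier →ₗ[Λ] (B j).carrier := e'.toLinearMap ∘ₗ φ ∘ₗ e.symm.toLinearMap
  have hf : f ≠ 0 := by
    intro h0
    obtain ⟨a, haA, haN⟩ := SetLike.exists_of_lt hNA
    have h1 : f (e (Submodule.Quotient.mk ⟨a, haA⟩)) = 0 := by rw [h0]; rfl
    simp only [f, LinearMap.comp_apply, LinearEquiv.coe_coe, LinearEquiv.symm_apply_apply,
      LinearEquiv.map_eq_zero_iff] at h1
    exact haN ((Submodule.Quotient.mk_eq_zero (N.comap C.subtype)).1 h1)
  have hij : i = j := by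
    by_contra h
    exact hf (horth i j h f)
  subst hij
  have hsurj : Function.Surjective f := (((hB i).2 f).resolve_left hf).2
  refine le_antisymm hAC fun x hx => ?_
  obtain ⟨y, hy⟩ := hsurj (e' (Submodule.Quotient.mk ⟨x, hx⟩))
  obtain ⟨⟨a, ha⟩, ha'⟩ := Submodule.Quotient.mk_surjective _ (e.symm y)
  have h2 : φ (e.symm y) = Submodule.Quotient.mk ⟨x, hx⟩ := e'.injective hy
  rw [← ha'] at h2
  have h3 : a - x ∈ N := (Submodule.Quotient.eq (N.comap C.subtype)).1 h2
  simpa using A.sub_mem ha (hNA.le h3)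

/-- over a Nakayama algebra, an indecomposable module has at most one
filtration with factors among a fixed collection of pairwise Hom-orthogonal
bricks. -/
theorem statement_7 (K : Type) [Field K] (Λ : Type) [Ring Λ] [Algebra K Λ]
    [FiniteDimensional K Λ] (hNak : IsNakayama Λ)
    (M : FDModule Λ) (hM : IsIndecomposableModule Λ M.carrier)
    {s : ℕ} (B : Fin s → FDModule Λ) (hB : ∀ i, IsBrick (B i))
    (horth : ∀ i j : Fin s, i ≠ j → NoHom (B i) (B j))
    {t₁ t₂ : ℕ}
    (c₁ : Fin (t₁ + 1) → Submodule Λ M.carrier)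
    (c₂ : Fin (t₂ + 1) → Submodule Λ M.carrier)
    (hc₁ : StrictMono c₁) (hc₁0 : c₁ 0 = ⊥) (hc₁t : c₁ (Fin.last t₁) = ⊤)
    (hf₁ : ∀ k : Fin t₁, ∃ i : Fin s,
      Nonempty ((↥(c₁ k.succ) ⧸ Submodule.comap (c₁ k.succ).subtype (c₁ k.castSucc))
        ≃ₗ[Λ] (B i).carrier))
    (hc₂ : StrictMono c₂) (hc₂0 : c₂ 0 = ⊥) (hc₂t : c₂ (Fin.last t₂) = ⊤)
    (hf₂ : ∀ k : Fin t₂, ∃ i : Fin s,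
      Nonempty ((↥(c₂ k.succ) ⧸ Submodule.comap (c₂ k.succ).subtype (c₂ k.castSucc))
        ≃ₗ[Λ] (B i).carrier)) :
    t₁ = t₂ ∧ ∀ (k : ℕ) (hk₁ : k < t₁ + 1) (hk₂ : k < t₂ + 1),
      c₁ ⟨k, hk₁⟩ = c₂ ⟨k, hk₂⟩ := by
  have hU := hNak M hM
  have key : ∀ (k : ℕ) (hk₁ : k < t₁ + 1) (hk₂ : k < t₂ + 1),
      c₁ ⟨k, hk₁⟩ = c₂ ⟨k, hk₂⟩ := by
    intro k
    induction k with
    | zero => intro _ _; exact hc₁0.trans hc₂0.symm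
    | succ k ih =>
      intro hk₁ hk₂
      have h := ih (by omega) (by omega)
      have hlt₁ : c₁ ⟨k, by omega⟩ < c₁ ⟨k + 1, hk₁⟩ := hc₁ (Fin.mk_lt_mk.2 k.lt_succ_self)
      have hlt₂ : c₂ ⟨k, by omega⟩ < c₂ ⟨k + 1, hk₂⟩ := hc₂ (Fin.mk_lt_mk.2 k.lt_succ_self)
      have hq₁ := hf₁ ⟨k, by omega⟩
      have hq₂ := hf₂ ⟨k, by omega⟩
      simp only [Fin.succ_mk, Fin.castSucc_mk] at hq₁ hq₂
      rw [h] at hq₁ hlt₁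
      rcases hU (c₁ ⟨k + 1, hk₁⟩) (c₂ ⟨k + 1, hk₂⟩) with hle | hle
      · exact eq_of_le_of_quotient_equiv_brick hB horth hlt₁ hle hq₁ hq₂
      · exact (eq_of_le_of_quotient_equiv_brick hB horth hlt₂ hle hq₂ hq₁).symm
  refine ⟨?_, key⟩
  rcases lt_trichotomy t₁ t₂ with h | h | h
  · have hlt : c₂ ⟨t₁, by omega⟩ < c₂ (Fin.last t₂) := hc₂ (Fin.mk_lt_mk.2 h)
    rw [← key t₁ (by omega) (by omega)] at hlt
    exact absurd (hc₁t.symm.trans_lt hlt) not_top_lt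
  · exact h
  · have hlt : c₁ ⟨t₂, by omega⟩ < c₁ (Fin.last t₁) := hc₁ (Fin.mk_lt_mk.2 h)
    rw [key t₂ (by omega) (by omega)] at hlt
    exact absurd (hc₂t.symm.trans_lt hlt) not_top_lt
end

section
/- Let Λ be a Nakayama algebra, B and B' bricks over Λ with Hom_Λ(B', B) = 0, L an indecomposable module lying in Filt(B), and N an indecomposable module lying in Filt(B'). Then Hom_Λ(N, L) = 0. -/
/-- If `Hom(X, B) = 0` and `L` lies in `Filt(B)`, then `Hom(X, L) = 0`. -/
theorem InFilt.linearMap_eq_zero_of_target {Λ : Type} [Ring Λ] {B : FDModule Λ}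
    {X L : Type} [AddCommGroup X] [Module Λ X] [AddCommGroup L] [Module Λ L]
    (hL : InFilt B L) (h : ∀ g : X →ₗ[Λ] B.carrier, g = 0) (f : X →ₗ[Λ] L) : f = 0 := by
  obtain ⟨t, c, -, h0, hlast, he⟩ := hL
  have key : ∀ k : Fin (t + 1), ∀ x, f x ∈ c k := by
    intro k
    induction k using Fin.reverseInduction with
    | last => simp [hlast]
    | cast k ih =>
      intro x
      obtain ⟨e⟩ := he k
      have hg := LinearMap.congr_fun
        (h (e.toLinearMap ∘ₗ Submodule.mkQ _ ∘ₗ f.codRestrict (c k.succ) ih)) x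
      simpa using hg
  ext x
  simpa [h0] using key 0 x

/-- If `Hom(B, Y) = 0` and `N` lies in `Filt(B)`, then `Hom(N, Y) = 0`. -/
theorem InFilt.linearMap_eq_zero_of_source {Λ : Type} [Ring Λ] {B : FDModule Λ}
    {N Y : Type} [AddCommGroup N] [Module Λ N] [AddCommGroup Y] [Module Λ Y]
    (hN : InFilt B N) (h : ∀ g : B.carrier →ₗ[Λ] Y, g = 0) (f : N →ₗ[Λ] Y) : f = 0 := by
  obtain ⟨t, c, -, h0, hlast, he⟩ := hN
  have key : ∀ k : Fin (t + 1), ∀ x ∈ c k, f x = 0 := by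
    intro k
    induction k using Fin.induction with
    | zero => simp [h0]
    | succ k ih =>
      intro x hx
      obtain ⟨e⟩ := he k
      have hg := LinearMap.congr_fun (h (Submodule.liftQ _ (f ∘ₗ (c k.succ).subtype)
        (fun y hy => ih y hy) ∘ₗ e.symm.toLinearMap)) (e (Submodule.mkQ _ ⟨x, hx⟩))
      rw [LinearMap.comp_apply, LinearEquiv.coe_coe, e.symm_apply_apply] at hg
      exact hg
  ext x
  exact key (Fin.last t) x (by simp [hlast])

/-- over a Nakayama algebra, if `B`, `B'` are bricks with
`Hom(B', B) = 0`, `L` is indecomposable in `Filt(B)` and `N` is indecomposable in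
`Filt(B')`, then `Hom(N, L) = 0`. -/
theorem statement_8 (K : Type) [Field K] (Λ : Type) [Ring Λ] [Algebra K Λ]
    [FiniteDimensional K Λ] (hNak : IsNakayama Λ)
    (B B' : FDModule Λ) (hB : IsBrick B) (hB' : IsBrick B') (hBB' : NoHom B' B)
    (L : FDModule Λ) (hLind : IsIndecomposableModule Λ L.carrier)
    (hLF : InFilt B L.carrier)
    (N : FDModule Λ) (hNind : IsIndecomposableModule Λ N.carrier)
    (hNF : InFilt B' N.carrier) :
    NoHom N L := by
  exact fun f => hNF.linearMap_eq_zero_of_source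
    (hLF.linearMap_eq_zero_of_target hBB') f
end

section
/- Let Λ be a Nakayama algebra and B, B' bricks over Λ with Hom_Λ(B', B) = 0. Then the only module lying in both Filt(B) and Filt(B') is the zero module. -/
/-- If `Hom(X, B) = 0`, then `Hom(X, M) = 0` for every `M` in `Filt(B)`. -/
theorem InFilt.hom_eq_zero {Λ : Type} [Ring Λ] {X B : FDModule Λ} (hXB : NoHom X B)
    {M : Type} [AddCommGroup M] [Module Λ M] (hM : InFilt B M) (f : X.carrier →ₗ[Λ] M) :
    f = 0 := by
  obtain ⟨t, c, -, h_bot, h_top, h_quot⟩ := hM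
  have h_mem : ∀ k, ∀ x, f x ∈ c k := by
    intro k
    induction k using Fin.reverseInduction with
    | last => simp [h_top]
    | cast k ih =>
      intro x
      obtain ⟨e⟩ := h_quot k
      have h_zero := LinearMap.congr_fun
        (hXB (e.toLinearMap ∘ₗ Submodule.mkQ _ ∘ₗ f.codRestrict (c k.succ) ih)) x
      simpa using h_zero
  ext x
  simpa [h_bot] using h_mem 0 x

/-- A module in `Filt(B)` which receives no non-zero map from `B` is zero. -/
theorem InFilt.subsingleton_of_hom_eq_zero {Λ : Type} [Ring Λ] {B : FDModule Λ}
    {M : Type} [AddCommGroup M] [Module Λ M] (hM : InFilt B M)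
    (h_hom : ∀ f : B.carrier →ₗ[Λ] M, f = 0) : Subsingleton M := by
  obtain ⟨t, c, -, h_bot, h_top, h_quot⟩ := hM
  have h_all : ∀ k, c k = ⊥ := by
    intro k
    induction k using Fin.induction with
    | zero => exact h_bot
    | succ k ih =>
      obtain ⟨e⟩ := h_quot k
      have h_comap : Submodule.comap (c k.succ).subtype (c k.castSucc) = ⊥ := by
        rw [ih, Submodule.comap_bot, Submodule.ker_subtype]
      let g := e.symm.trans (Submodule.quotEquivOfEqBot _ h_comap)
      refine (Submodule.eq_bot_iff _).2 fun x hx => ?_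
      have h_zero := LinearMap.congr_fun (h_hom ((c k.succ).subtype ∘ₗ g.toLinearMap))
        (g.symm ⟨x, hx⟩)
      simpa using h_zero
  rw [← Submodule.subsingleton_iff Λ, ← subsingleton_iff_bot_eq_top, ← h_top, h_all]


/-- over a Nakayama algebra, if `B`, `B'` are bricks with
`Hom(B', B) = 0`, then the only module lying in both `Filt(B)` and `Filt(B')` is
the zero module. -/
theorem statement_9 (K : Type) [Field K] (Λ : Type) [Ring Λ] [Algebra K Λ]
    [FiniteDimensional K Λ] (hNak : IsNakayama Λ)
    (B B' : FDModule Λ) (hB : IsBrick B) (hB' : IsBrick B') (hBB' : NoHom B' B)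
    (M : FDModule Λ) (hMB : InFilt B M.carrier) (hMB' : InFilt B' M.carrier) :
    Subsingleton M.carrier := by
  exact hMB'.subsingleton_of_hom_eq_zero (hMB.hom_eq_zero hBB')
end

section
/- Let Λ be a Nakayama algebra, B a brick over Λ, and M an indecomposable module lying in Filt(B). Then every endomorphism f of M is zero, or is an isomorphism, or has the property that its image is a non-zero proper submodule of M lying in Filt(B) and its kernel is a non-zero proper submodule of M lying in Filt(B). -/
/-- Iterated extensions by `B`, built up by adding one copy of `B` as a submodule at a time. -/
inductive IsIteratedExtension (Λ : Type) [Ring Λ] (B : Type) [AddCommGroup B] [Module Λ B] :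
    (M : Type) → [AddCommGroup M] → [Module Λ M] → Prop
  | zero (M : Type) [AddCommGroup M] [Module Λ M] (h : Subsingleton M) :
      IsIteratedExtension Λ B M
  | ext (M Q : Type) [AddCommGroup M] [Module Λ M] [AddCommGroup Q] [Module Λ Q]
      (i : B →ₗ[Λ] M) (p : M →ₗ[Λ] Q) (hi : Function.Injective i)
      (hp : Function.Surjective p) (hex : ∀ x, p x = 0 ↔ ∃ b, i b = x)
      (hQ : IsIteratedExtension Λ B Q) : IsIteratedExtension Λ B M

section

variable {Λ : Type} [Ring Λ]

/-- A linear map vanishing on the kernel of a surjection factors through it. -/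
theorem exists_comp_eq_of_surjective {M Q N : Type} [AddCommGroup M] [Module Λ M]
    [AddCommGroup Q] [Module Λ Q] [AddCommGroup N] [Module Λ N] (p : M →ₗ[Λ] Q)
    (hp : Function.Surjective p) (f : M →ₗ[Λ] N) (h : ∀ x, p x = 0 → f x = 0) :
    ∃ g : Q →ₗ[Λ] N, ∀ x, g (p x) = f x := by
  refine ⟨(LinearMap.ker p).liftQ f (fun x hx => h x hx) ∘ₗ
    (p.quotKerEquivOfSurjective hp).symm.toLinearMap, fun x => ?_⟩
  have : (p.quotKerEquivOfSurjective hp).symm (p x) = (LinearMap.ker p).mkQ x := by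
    rw [LinearEquiv.symm_apply_eq]; rfl
  rw [LinearMap.comp_apply, LinearEquiv.coe_coe, this]
  exact Submodule.liftQ_apply _ _ _

theorem nonempty_quotient_comap_equiv_iff {M B : Type} [AddCommGroup M] [Module Λ M]
    [AddCommGroup B] [Module Λ B] (P N : Submodule Λ M) :
    Nonempty ((↥N ⧸ Submodule.comap N.subtype P) ≃ₗ[Λ] B) ↔
      ∃ g : N →ₗ[Λ] B, Function.Surjective g ∧ ∀ x : N, g x = 0 ↔ (x : M) ∈ P := by
  constructor
  · rintro ⟨e⟩
    refine ⟨e.toLinearMap ∘ₗ Submodule.mkQ _, e.surjective.comp (Submodule.mkQ_surjective _),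
      fun x => ?_⟩
    simp
  · rintro ⟨g, hg, hx⟩
    have hk : Submodule.comap N.subtype P = LinearMap.ker g := by
      ext x
      simp [hx]
    exact ⟨(Submodule.quotEquivOfEq _ _ hk).trans (g.quotKerEquivOfSurjective hg)⟩

namespace IsIteratedExtension

variable {B : Type} [AddCommGroup B] [Module Λ B]

theorem of_equiv {M N : Type} [AddCommGroup M] [Module Λ M] [AddCommGroup N] [Module Λ N]
    (e : M ≃ₗ[Λ] N) (h : IsIteratedExtension Λ B M) :
    IsIteratedExtension Λ B N := by
  cases h with
  | zero _ h => exact zero _ e.symm.injective.subsingleton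
  | ext _ Q i p hi hp hex hQ =>
    refine ext N Q (e.toLinearMap ∘ₗ i) (p ∘ₗ e.symm.toLinearMap) (e.injective.comp hi)
      (hp.comp e.symm.surjective) (fun x => ?_) hQ
    simp [hex, LinearEquiv.eq_symm_apply]

/-- A non-zero map from a brick `B` to an iterated extension of `B` is injective, and its
cokernel is again an iterated extension of `B`. -/
theorem injective_and_quotient_range
    (hB : ∀ f : B →ₗ[Λ] B, f = 0 ∨ Function.Bijective f)
    {N : Type} [AddCommGroup N] [Module Λ N] (hN : IsIteratedExtension Λ B N)
    (f : B →ₗ[Λ] N) (hf : f ≠ 0) :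
    Function.Injective f ∧ IsIteratedExtension Λ B (N ⧸ LinearMap.range f) := by
  induction hN with
  | zero N h => exact absurd (LinearMap.ext fun x => Subsingleton.elim _ _) hf
  | ext N Q i p hi hp hex hQ ih =>
    by_cases h0 : p ∘ₗ f = 0
    · have hmem : ∀ x, f x ∈ LinearMap.range i := fun x =>
        (hex _).1 (LinearMap.congr_fun h0 x)
      let e := LinearEquiv.ofInjective i hi
      let g : B →ₗ[Λ] B := e.symm.toLinearMap ∘ₗ f.codRestrict (LinearMap.range i) hmem
      have hg : ∀ x, i (g x) = f x := fun x => by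
        have : e (g x) = f.codRestrict (LinearMap.range i) hmem x := e.apply_symm_apply _
        exact congrArg Subtype.val this
      rcases hB g with h | h
      · refine absurd (LinearMap.ext fun x => ?_) hf
        rw [← hg, h]
        simp
      · have hr : LinearMap.ker p = LinearMap.range f := by
          ext x
          rw [LinearMap.mem_ker, hex, LinearMap.mem_range]
          constructor
          · rintro ⟨b, rfl⟩
            obtain ⟨a, rfl⟩ := h.2 b
            exact ⟨a, (hg a).symm⟩
          · rintro ⟨a, rfl⟩
            exact ⟨g a, hg a⟩
        refine ⟨fun x y hxy => h.1 (hi ?_), of_equiv ?_ hQ⟩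
        · rw [hg, hg, hxy]
        · exact (p.quotKerEquivOfSurjective hp).symm.trans (Submodule.quotEquivOfEq _ _ hr)
    · obtain ⟨hinj, hquot⟩ := ih (p ∘ₗ f) h0
      refine ⟨fun x y hxy => hinj (congrArg p hxy), ?_⟩
      have hle : LinearMap.range f ≤ (LinearMap.range (p ∘ₗ f)).comap p := by
        rintro _ ⟨x, rfl⟩
        exact ⟨x, rfl⟩
      refine ext _ _ ((LinearMap.range f).mkQ ∘ₗ i)
        (Submodule.mapQ _ (LinearMap.range (p ∘ₗ f)) p hle) ?_ ?_ ?_ hquot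
      · rw [← LinearMap.ker_eq_bot, LinearMap.ker_eq_bot']
        intro b hb
        obtain ⟨a, ha⟩ : i b ∈ LinearMap.range f := by simpa using hb
        have h1 : p (f a) = 0 := (hex _).2 ⟨b, ha.symm⟩
        have h2 : a = 0 := hinj (by simpa using h1)
        apply hi
        rw [← ha, h2, map_zero, map_zero]
      · intro y
        obtain ⟨y, rfl⟩ := Submodule.mkQ_surjective _ y
        obtain ⟨x, rfl⟩ := hp y
        exact ⟨Submodule.Quotient.mk x, rfl⟩
      · intro x
        obtain ⟨x, rfl⟩ := Submodule.mkQ_surjective _ x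
        simp only [Submodule.mkQ_apply, Submodule.mapQ_apply, LinearMap.comp_apply,
          Submodule.Quotient.mk_eq_zero, Submodule.Quotient.eq]
        constructor
        · rintro ⟨a, ha⟩
          obtain ⟨b, hb⟩ := (hex (x - f a)).1 (by rw [map_sub, ← ha]; simp)
          exact ⟨b, -a, by rw [hb, map_neg]; abel⟩
        · rintro ⟨b, a, ha⟩
          refine ⟨-a, ?_⟩
          have h1 : p (i b) = 0 := (hex _).2 ⟨b, rfl⟩
          have h2 := congrArg p ha
          rw [map_sub, h1] at h2
          simp [h2]

/-- Iterated extensions of a brick are closed under kernels and images. -/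
theorem ker_and_range
    (hB : ∀ f : B →ₗ[Λ] B, f = 0 ∨ Function.Bijective f)
    {M : Type} [AddCommGroup M] [Module Λ M] (hM : IsIteratedExtension Λ B M)
    {N : Type} [AddCommGroup N] [Module Λ N] (hN : IsIteratedExtension Λ B N)
    (f : M →ₗ[Λ] N) :
    IsIteratedExtension Λ B (LinearMap.ker f) ∧
      IsIteratedExtension Λ B (LinearMap.range f) := by
  induction hM generalizing N with
  | zero M h =>
    exact ⟨zero _ inferInstance, zero _ f.surjective_rangeRestrict.subsingleton⟩
  | ext M Q i p hi hp hex hQ ih =>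
    by_cases h0 : f ∘ₗ i = 0
    · have hfi : ∀ b, f (i b) = 0 := fun b => LinearMap.congr_fun h0 b
      obtain ⟨g, hg⟩ := exists_comp_eq_of_surjective p hp f (fun x hx => by
        obtain ⟨b, rfl⟩ := (hex x).1 hx
        exact hfi b)
      obtain ⟨hker, hrange⟩ := ih hN g
      have hr : LinearMap.range g = LinearMap.range f := by
        ext y
        constructor
        · rintro ⟨q, rfl⟩
          obtain ⟨x, rfl⟩ := hp q
          exact ⟨x, (hg x).symm⟩
        · rintro ⟨x, rfl⟩
          exact ⟨p x, hg x⟩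
      refine ⟨ext _ _ (i.codRestrict (LinearMap.ker f) hfi)
        (p.restrict (p := LinearMap.ker f) (q := LinearMap.ker g)
          (fun x hx => by rw [LinearMap.mem_ker, hg]; exact hx)) ?_ ?_ ?_ hker,
        of_equiv (LinearEquiv.ofEq _ _ hr) hrange⟩
      · exact fun x y hxy => hi (congrArg Subtype.val hxy)
      · rintro ⟨q, hq⟩
        obtain ⟨x, rfl⟩ := hp q
        exact ⟨⟨x, by rw [LinearMap.mem_ker, ← hg]; exact hq⟩, rfl⟩
      · rintro ⟨x, hx⟩
        simp only [Subtype.ext_iff]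
        exact hex x
    · obtain ⟨hinj, hquot⟩ := injective_and_quotient_range hB hN (f ∘ₗ i) h0
      let q := (LinearMap.range (f ∘ₗ i)).mkQ
      have hq : ∀ y, q y = 0 ↔ ∃ b, f (i b) = y := fun y => by
        simp [q]
      obtain ⟨g, hg⟩ := exists_comp_eq_of_surjective p hp (q ∘ₗ f) (fun x hx => by
        obtain ⟨b, rfl⟩ := (hex x).1 hx
        exact (hq _).2 ⟨b, rfl⟩)
      have hpi : ∀ b, p (i b) = 0 := fun b => (hex _).2 ⟨b, rfl⟩
      obtain ⟨hker, hrange⟩ := ih hquot g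
      constructor
      · let r := p.restrict (p := LinearMap.ker f) (q := LinearMap.ker g)
          (fun x hx => by
            rw [LinearMap.mem_ker, hg, LinearMap.comp_apply, LinearMap.mem_ker.1 hx, map_zero])
        have hr : Function.Bijective r := by
          constructor
          · rw [← LinearMap.ker_eq_bot, LinearMap.ker_eq_bot']
            rintro ⟨x, hx⟩ h
            obtain ⟨b, rfl⟩ := (hex x).1 (congrArg Subtype.val h)
            have hb : b = 0 := hinj (by simpa using hx)
            simp [hb]
          · rintro ⟨y, hy⟩
            obtain ⟨x, rfl⟩ := hp y
            rw [LinearMap.mem_ker, hg] at hy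
            obtain ⟨b, hb⟩ := (hq _).1 hy
            refine ⟨⟨x - i b, by simp [hb]⟩, Subtype.ext ?_⟩
            change p (x - i b) = p x
            rw [map_sub, hpi, sub_zero]
        exact of_equiv (LinearEquiv.ofBijective r hr).symm hker
      · refine ext _ _ (f.rangeRestrict ∘ₗ i)
          (q.restrict (p := LinearMap.range f) (q := LinearMap.range g)
            (by rintro _ ⟨x, rfl⟩; exact ⟨p x, hg x⟩)) ?_ ?_ ?_ hrange
        · exact fun x y hxy => hinj (congrArg Subtype.val hxy)
        · rintro ⟨_, y, rfl⟩
          obtain ⟨x, rfl⟩ := hp y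
          exact ⟨⟨f x, x, rfl⟩, Subtype.ext (hg x).symm⟩
        · rintro ⟨y, hy⟩
          simp only [Subtype.ext_iff]
          exact hq y

theorem of_inFilt {B : FDModule Λ} {M : Type} [AddCommGroup M] [Module Λ M]
    (h : InFilt B M) : IsIteratedExtension Λ B.carrier M := by
  obtain ⟨t, c, hmono, hbot, htop, hc⟩ := h
  have key : ∀ k : Fin (t + 1), IsIteratedExtension Λ B.carrier (M ⧸ c k) := by
    intro k
    induction k using Fin.reverseInduction with
    | last =>
      rw [htop]
      exact zero _ inferInstance
    | cast k ih =>
      obtain ⟨e⟩ := hc k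
      have hle : c k.castSucc ≤ c k.succ := hmono k.castSucc_lt_succ.le
      refine ext _ _ (Submodule.mapQ _ (c k.castSucc) (c k.succ).subtype le_rfl ∘ₗ
        e.symm.toLinearMap) (Submodule.factor hle) ?_ (Submodule.factor_surjective hle) ?_ ih
      · rw [LinearMap.coe_comp]
        refine Function.Injective.comp ?_ e.symm.injective
        rw [← LinearMap.ker_eq_bot, LinearMap.ker_eq_bot']
        intro x hx
        obtain ⟨x, rfl⟩ := Submodule.mkQ_surjective _ x
        simpa using hx
      · intro x
        obtain ⟨x, rfl⟩ := Submodule.mkQ_surjective _ x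
        rw [Submodule.factor_mk, Submodule.mkQ_apply, Submodule.Quotient.mk_eq_zero]
        constructor
        · intro hx
          exact ⟨e (Submodule.Quotient.mk ⟨x, hx⟩), by simp⟩
        · rintro ⟨b, hb⟩
          obtain ⟨y, hy⟩ := Submodule.mkQ_surjective _ (e.symm b)
          rw [LinearMap.comp_apply, LinearEquiv.coe_coe, ← hy, Submodule.mkQ_apply,
            Submodule.mapQ_apply, Submodule.mkQ_apply, Submodule.Quotient.eq] at hb
          have := sub_mem y.2 (hle hb)
          simpa using this
  exact of_equiv (Submodule.quotEquivOfEqBot _ hbot) (key 0)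

theorem inFilt {B : FDModule Λ} {M : Type} [AddCommGroup M] [Module Λ M]
    (h : IsIteratedExtension Λ B.carrier M) : InFilt B M := by
  induction h with
  | zero M h =>
    exact ⟨0, fun _ => ⊥, monotone_const, rfl, Subsingleton.elim _ _, fun k => k.elim0⟩
  | ext M Q i p hi hp hex hQ ih =>
    obtain ⟨t, d, hmono, hbot, htop, hd⟩ := ih
    refine ⟨t + 1, Fin.cons ⊥ fun k => (d k).comap p, ?_, rfl, ?_, ?_⟩
    · intro a b hab
      induction a using Fin.cases with
      | zero => exact bot_le
      | succ a =>
        induction b using Fin.cases with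
        | zero => exact absurd hab (by simp)
        | succ b => exact Submodule.comap_mono (hmono (Fin.succ_le_succ_iff.1 hab))
    · rw [← Fin.succ_last, Fin.cons_succ, htop, Submodule.comap_top]
    · intro k
      rw [nonempty_quotient_comap_equiv_iff]
      induction k using Fin.cases with
      | zero =>
        have hr : (d 0).comap p = LinearMap.range i := by
          ext x
          simp [hbot, hex]
        let e := (LinearEquiv.ofEq _ _ hr).trans (LinearEquiv.ofInjective i hi).symm
        refine ⟨e.toLinearMap, e.surjective, fun x => ?_⟩
        change e x = 0 ↔ (x : M) ∈ (⊥ : Submodule Λ M)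
        rw [Submodule.mem_bot, ZeroMemClass.coe_eq_zero]
        exact e.map_eq_zero_iff
      | succ k =>
        obtain ⟨g, hg, hx⟩ := (nonempty_quotient_comap_equiv_iff _ _).1 (hd k)
        refine ⟨g ∘ₗ p.restrict (p := (d k.succ).comap p) (q := d k.succ) (fun x hx => hx),
          hg.comp ?_, fun x => hx _⟩
        rintro ⟨y, hy⟩
        obtain ⟨x, rfl⟩ := hp y
        exact ⟨⟨x, hy⟩, rfl⟩

end IsIteratedExtension

end

/-- over a Nakayama algebra, every endomorphism of an indecomposable
module `M` in `Filt(B)` (for a brick `B`) is zero, an isomorphism, or has image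
and kernel non-zero proper submodules of `M` lying in `Filt(B)`. -/
theorem statement_10 (K : Type) [Field K] (Λ : Type) [Ring Λ] [Algebra K Λ]
    [FiniteDimensional K Λ] (hNak : IsNakayama Λ)
    (B : FDModule Λ) (hB : IsBrick B)
    (M : FDModule Λ) (hM : IsIndecomposableModule Λ M.carrier)
    (hMF : InFilt B M.carrier)
    (f : M.carrier →ₗ[Λ] M.carrier) :
    f = 0 ∨ Function.Bijective f ∨
      (LinearMap.range f ≠ ⊥ ∧ LinearMap.range f ≠ ⊤ ∧
        InFilt B ↥(LinearMap.range f) ∧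
        LinearMap.ker f ≠ ⊥ ∧ LinearMap.ker f ≠ ⊤ ∧
        InFilt B ↥(LinearMap.ker f)) := by
  have hE := IsIteratedExtension.of_inFilt hMF
  obtain ⟨hker, hrange⟩ := hE.ker_and_range hB.2 hE f
  have : IsArtinianRing Λ := IsArtinianRing.of_finite K Λ
  by_cases h0 : f = 0
  · exact Or.inl h0
  by_cases hbij : Function.Bijective f
  · exact Or.inr (Or.inl hbij)
  refine Or.inr (Or.inr ⟨fun h => h0 (LinearMap.range_eq_bot.1 h), fun h => hbij ?_,
    hrange.inFilt, fun h => hbij ?_, fun h => h0 (LinearMap.ker_eq_top.1 h), hker.inFilt⟩)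
  · exact IsNoetherian.bijective_of_surjective_endomorphism f (LinearMap.range_eq_top.1 h)
  · exact IsArtinian.bijective_of_injective_endomorphism f (LinearMap.ker_eq_bot.1 h)
end

section
/- Let Λ be a Nakayama algebra, B and B' bricks over Λ with Hom_Λ(B', B) = 0, L an indecomposable module lying in Filt(B), and N an indecomposable module lying in Filt(B'). Then for every non-split short exact sequence 0 → L → M → N → 0 with M indecomposable, the middle term M is a brick. -/
/-- `X` is isomorphic to the subquotient `T / S`, witnessed by a surjection `T → X` whose
kernel is `S`. -/
def HasFactor {Λ : Type} [Ring Λ] {M : Type} [AddCommGroup M] [Module Λ M]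
    (S T : Submodule Λ M) (X : Type) [AddCommGroup X] [Module Λ X] : Prop :=
  ∃ p : T →ₗ[Λ] X, Function.Surjective p ∧ ∀ x : T, p x = 0 ↔ (x : M) ∈ S

section Factors

variable {Λ : Type} [Ring Λ] {M : Type} [AddCommGroup M] [Module Λ M]
  {M' : Type} [AddCommGroup M'] [Module Λ M']
  {X : Type} [AddCommGroup X] [Module Λ X] {X' : Type} [AddCommGroup X'] [Module Λ X']

theorem LinearMap.exists_factor_of_surjective (q : M →ₗ[Λ] X) (hq : Function.Surjective q)
    (p : M →ₗ[Λ] X') (h : ∀ x, q x = 0 → p x = 0) :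
    ∃ r : X →ₗ[Λ] X', ∀ x, r (q x) = p x := by
  have hle : LinearMap.ker q ≤ LinearMap.ker p := fun x hx => h x hx
  refine ⟨(Submodule.liftQ _ p hle).comp (q.quotKerEquivOfSurjective hq).symm.toLinearMap,
    fun x => ?_⟩
  have : (q.quotKerEquivOfSurjective hq).symm (q x) = Submodule.Quotient.mk x := by
    rw [LinearEquiv.symm_apply_eq]
    rfl
  simp [this]

theorem HasFactor.exists_notMem [Nontrivial X] {S T : Submodule Λ M} (h : HasFactor S T X) :
    ∃ x ∈ T, x ∉ S := by
  obtain ⟨p, hp, hk⟩ := h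
  obtain ⟨y, hy⟩ := exists_ne (0 : X)
  obtain ⟨x, rfl⟩ := hp y
  exact ⟨x, x.2, fun hx => hy ((hk x).2 hx)⟩

theorem HasFactor.map_injective {S T : Submodule Λ M} (h : HasFactor S T X)
    (f : M →ₗ[Λ] M') (hf : Function.Injective f) : HasFactor (S.map f) (T.map f) X := by
  obtain ⟨p, hp, hk⟩ := h
  refine ⟨p.comp (Submodule.equivMapOfInjective f hf T).symm.toLinearMap,
    hp.comp (LinearEquiv.surjective _), fun x => ?_⟩
  obtain ⟨y, rfl⟩ := (Submodule.equivMapOfInjective f hf T).surjective x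
  simp [hk, hf.eq_iff]

theorem HasFactor.comap {S T : Submodule Λ M'} (h : HasFactor S T X)
    (g : M →ₗ[Λ] M') (hg : T ≤ LinearMap.range g) : HasFactor (S.comap g) (T.comap g) X := by
  obtain ⟨p, hp, hk⟩ := h
  refine ⟨p.comp (g.restrict fun x hx => hx), hp.comp ?_, fun x => hk _⟩
  rintro ⟨y, hy⟩
  obtain ⟨x, rfl⟩ := hg hy
  exact ⟨⟨x, hy⟩, rfl⟩

theorem HasFactor.map_of_ker_le {S T : Submodule Λ M} (h : HasFactor S T X)
    (q : M →ₗ[Λ] M') (hS : LinearMap.ker q ≤ S) :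
    HasFactor (S.map q) (T.map q) X := by
  obtain ⟨p, hp, hk⟩ := h
  have hs : Function.Surjective (q.submoduleMap T) := q.submoduleMap_surjective T
  have hmem : ∀ x : M, q x ∈ S.map q → x ∈ S := by
    rintro x ⟨s, hs, e⟩
    have : x - s ∈ LinearMap.ker q := by simp [e]
    simpa using S.add_mem (hS this) hs
  obtain ⟨r, hr⟩ := LinearMap.exists_factor_of_surjective (q.submoduleMap T) hs p fun x hx =>
    (hk x).2 (hS (by simpa using congrArg Subtype.val hx))
  refine ⟨r, fun y => ?_, fun y => ?_⟩
  · obtain ⟨x, rfl⟩ := hp y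
    exact ⟨_, hr x⟩
  · obtain ⟨x, rfl⟩ := hs y
    rw [hr, hk]
    exact ⟨fun h => ⟨x, h, rfl⟩, fun h => hmem _ h⟩

theorem hasFactor_of_equiv {S T : Submodule Λ M}
    (e : (↥T ⧸ Submodule.comap T.subtype S) ≃ₗ[Λ] X) : HasFactor S T X :=
  ⟨e.toLinearMap.comp (Submodule.mkQ _), e.surjective.comp (Submodule.mkQ_surjective _),
    fun x => by simp⟩

theorem exists_induced {S T : Submodule Λ M} {S' T' : Submodule Λ M}
    {p : T →ₗ[Λ] X} (hp : Function.Surjective p) (hk : ∀ x : T, p x = 0 ↔ (x : M) ∈ S)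
    {p' : T' →ₗ[Λ] X'} (hk' : ∀ x : T', p' x = 0 ↔ (x : M) ∈ S')
    (φ : M →ₗ[Λ] M) (hT : ∀ x ∈ T, φ x ∈ T') (hS : ∀ x ∈ S, φ x ∈ S') :
    ∃ ψ : X →ₗ[Λ] X', ∀ x : T, ψ (p x) = p' ⟨φ x, hT x x.2⟩ :=
  LinearMap.exists_factor_of_surjective p hp (p'.comp (φ.restrict hT)) fun x hx =>
    (hk' _).2 (hS x ((hk x).1 hx))

theorem NoHom.map_mem {B B' : FDModule Λ} (h : NoHom B' B) {S T S' T' : Submodule Λ M}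
    (hB' : HasFactor S T B'.carrier) (hB : HasFactor S' T' B.carrier)
    (φ : M →ₗ[Λ] M) (hT : ∀ x ∈ T, φ x ∈ T') (hS : ∀ x ∈ S, φ x ∈ S') :
    ∀ x ∈ T, φ x ∈ S' := by
  obtain ⟨p, hp, hk⟩ := hB'
  obtain ⟨p', hp', hk'⟩ := hB
  obtain ⟨ψ, hψ⟩ := exists_induced hp hk hk' φ hT hS
  intro x hx
  refine (hk' ⟨φ x, hT x hx⟩).1 ?_
  rw [← hψ ⟨x, hx⟩, h ψ, LinearMap.zero_apply]

theorem IsBrick.map_mem_or {B : FDModule Λ} (h : IsBrick B) {S T : Submodule Λ M}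
    (hB : HasFactor S T B.carrier)
    (φ : M →ₗ[Λ] M) (hT : ∀ x ∈ T, φ x ∈ T) (hS : ∀ x ∈ S, φ x ∈ S) :
    (∀ x ∈ T, φ x ∈ S) ∨
      ((∀ x ∈ T, φ x ∈ S → x ∈ S) ∧ ∀ y ∈ T, ∃ x ∈ T, y - φ x ∈ S) := by
  obtain ⟨p, hp, hk⟩ := hB
  obtain ⟨ψ, hψ⟩ := exists_induced hp hk hk φ hT hS
  rcases h.2 ψ with h0 | hb
  · refine Or.inl fun x hx => (hk ⟨φ x, hT x hx⟩).1 ?_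
    rw [← hψ ⟨x, hx⟩, h0, LinearMap.zero_apply]
  · refine Or.inr ⟨fun x hx h => (hk ⟨x, hx⟩).1 (hb.1 ?_), fun y hy => ?_⟩
    · rw [map_zero, hψ]
      exact (hk _).2 h
    · obtain ⟨z, hz⟩ := hb.2 (p ⟨y, hy⟩)
      obtain ⟨x, rfl⟩ := hp z
      rw [hψ] at hz
      refine ⟨x, x.2, (hk (⟨y, hy⟩ - ⟨φ x, hT x x.2⟩)).1 ?_⟩
      rw [map_sub, hz, sub_self]

theorem IsUniserialModule.submodule (h : IsUniserialModule Λ M) (Q : Submodule Λ M) :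
    IsUniserialModule Λ Q := fun N₁ N₂ => by
  rcases h (N₁.map Q.subtype) (N₂.map Q.subtype) with h | h
  · exact Or.inl ((Submodule.map_le_map_iff_of_injective Q.injective_subtype _ _).1 h)
  · exact Or.inr ((Submodule.map_le_map_iff_of_injective Q.injective_subtype _ _).1 h)

theorem IsUniserialModule.quotient (h : IsUniserialModule Λ M) (A : Submodule Λ M) :
    IsUniserialModule Λ (M ⧸ A) := fun N₁ N₂ => by
  rcases h (N₁.comap A.mkQ) (N₂.comap A.mkQ) with h | h
  · exact Or.inl ((Submodule.comap_le_comap_iff_of_surjective A.mkQ_surjective).1 h)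
  · exact Or.inr ((Submodule.comap_le_comap_iff_of_surjective A.mkQ_surjective).1 h)

theorem IsUniserialModule.eq_bot_or_eq_bot (h : IsUniserialModule Λ M) {S T : Submodule Λ M}
    (hST : S ⊓ T = ⊥) : S = ⊥ ∨ T = ⊥ := by
  rcases h S T with h | h
  · exact Or.inl (by rwa [inf_eq_left.2 h] at hST)
  · exact Or.inr (by rwa [inf_eq_right.2 h] at hST)

theorem IsUniserialModule.eq_top_or_eq_top (h : IsUniserialModule Λ M) {S T : Submodule Λ M}
    (hST : S ⊔ T = ⊤) : S = ⊤ ∨ T = ⊤ := by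
  rcases h S T with h | h
  · exact Or.inr (by rwa [sup_eq_right.2 h] at hST)
  · exact Or.inl (by rwa [sup_eq_left.2 h] at hST)

end Factors

section Nakayama

variable {Λ : Type} [Ring Λ] {U : Type} [AddCommGroup U] [Module Λ U] [Module.Finite Λ U]

/-- Uniserial modules over a Nakayama algebra are quasi-injective. -/
theorem IsNakayama.exists_extend [IsArtinianRing Λ] (hNak : IsNakayama Λ)
    (hU : IsUniserialModule Λ U) (V : Submodule Λ U) (h : V →ₗ[Λ] U) :
    ∃ φ : U →ₗ[Λ] U, ∀ v : V, φ v = h v := by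
  rcases subsingleton_or_nontrivial U with hs | hnt
  · exact ⟨0, fun v => Subsingleton.elim _ _⟩
  let G : Submodule Λ (U × U) := LinearMap.range (V.subtype.prod (-h))
  have hG : G.comap (LinearMap.inr Λ U U) = ⊥ := by
    rw [eq_bot_iff]
    rintro u ⟨v, hv⟩
    have h1 := congrArg Prod.fst hv
    have h2 := congrArg Prod.snd hv
    have hv0 : v = 0 := Subtype.ext (by simpa using h1)
    subst hv0
    simpa using h2.symm
  obtain ⟨D, ⟨hGD, hD⟩, hmax⟩ := WellFounded.has_min
    (wellFounded_gt (α := Submodule Λ (U × U)))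
    {D | G ≤ D ∧ D.comap (LinearMap.inr Λ U U) = ⊥} ⟨G, le_rfl, hG⟩
  let j₁ : U →ₗ[Λ] (U × U) ⧸ D := D.mkQ.comp (LinearMap.inl Λ U U)
  let j₂ : U →ₗ[Λ] (U × U) ⧸ D := D.mkQ.comp (LinearMap.inr Λ U U)
  have hj₂ : Function.Injective j₂ := by
    rw [← LinearMap.ker_eq_bot, LinearMap.ker_comp, Submodule.ker_mkQ, hD]
  have hess : ∀ N : Submodule Λ ((U × U) ⧸ D), N.comap j₂ = ⊥ → N = ⊥ := by
    intro N hN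
    have hle : D ≤ N.comap D.mkQ := Submodule.le_comap_mkQ D N
    have hnot := hmax (N.comap D.mkQ) ⟨hGD.trans hle, hN⟩
    have heq : D = N.comap D.mkQ := by
      by_contra hne
      exact hnot (lt_of_le_of_ne hle hne)
    rw [← Submodule.map_comap_eq_of_surjective D.mkQ_surjective N, ← heq, Submodule.mkQ_map_self]
  have hind : IsIndecomposableModule Λ ((U × U) ⧸ D) := by
    refine ⟨hj₂.nontrivial, fun N₁ N₂ hc => ?_⟩
    have : N₁.comap j₂ ⊓ N₂.comap j₂ = ⊥ := by
      rw [← Submodule.comap_inf, hc.inf_eq_bot]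
      exact LinearMap.ker_eq_bot.2 hj₂
    exact (hU.eq_bot_or_eq_bot this).imp (hess _) (hess _)
  have huni : IsUniserialModule Λ ((U × U) ⧸ D) := hNak ⟨(U × U) ⧸ D⟩ hind
  have hsup : LinearMap.range j₁ ⊔ LinearMap.range j₂ = ⊤ := by
    rw [LinearMap.range_comp, LinearMap.range_comp, ← Submodule.map_sup,
      LinearMap.sup_range_inl_inr, Submodule.map_top, Submodule.range_mkQ]
  have hsurj : Function.Surjective j₂ := by
    rcases huni.eq_top_or_eq_top hsup with h1 | h2
    · have hj₁ : Function.Surjective j₁ := LinearMap.range_eq_top.1 h1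
      have hi := OrzechProperty.injective_of_surjective_of_injective j₂ j₁ hj₂ hj₁
      let e := LinearEquiv.ofBijective j₁ ⟨hi, hj₁⟩
      have hs : Function.Surjective (e.symm.toLinearMap.comp j₂) :=
        IsArtinian.surjective_of_injective_endomorphism _ (e.symm.injective.comp hj₂)
      intro x
      obtain ⟨u, hu⟩ := hs (e.symm x)
      exact ⟨u, e.symm.injective hu⟩
    · exact LinearMap.range_eq_top.1 h2
  let e := LinearEquiv.ofBijective j₂ ⟨hj₂, hsurj⟩
  refine ⟨e.symm.toLinearMap.comp j₁, fun v => ?_⟩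
  change e.symm (j₁ v) = h v
  rw [LinearEquiv.symm_apply_eq]
  change D.mkQ _ = D.mkQ _
  rw [← sub_eq_zero, ← map_sub, Submodule.mkQ_apply, Submodule.Quotient.mk_eq_zero]
  exact hGD ⟨v, by ext <;> simp⟩

/-- Uniserial modules over a Nakayama algebra are quasi-projective. -/
theorem IsNakayama.exists_lift [IsArtinianRing Λ] (hNak : IsNakayama Λ)
    (hU : IsUniserialModule Λ U) {X : Type} [AddCommGroup X] [Module Λ X]
    (q : U →ₗ[Λ] X) (hq : Function.Surjective q) (h : U →ₗ[Λ] X) :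
    ∃ φ : U →ₗ[Λ] U, ∀ u, q (φ u) = h u := by
  rcases subsingleton_or_nontrivial U with hs | hnt
  · refine ⟨0, fun u => ?_⟩
    rw [Subsingleton.elim u 0]
    simp
  let W : Submodule Λ (U × U) :=
    LinearMap.ker (h.comp (LinearMap.fst Λ U U) - q.comp (LinearMap.snd Λ U U))
  have hW : W.map (LinearMap.fst Λ U U) = ⊤ := by
    rw [eq_top_iff]
    intro u _
    obtain ⟨v, hv⟩ := hq (h u)
    exact ⟨(u, v), by simp [W, hv], rfl⟩
  obtain ⟨C, ⟨hCW, hC⟩, hmin⟩ := WellFounded.has_min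
    (wellFounded_lt (α := Submodule Λ (U × U)))
    {C | C ≤ W ∧ C.map (LinearMap.fst Λ U U) = ⊤} ⟨W, le_rfl, hW⟩
  let p₁ : C →ₗ[Λ] U := (LinearMap.fst Λ U U).comp C.subtype
  let p₂ : C →ₗ[Λ] U := (LinearMap.snd Λ U U).comp C.subtype
  have hp₁ : Function.Surjective p₁ := by
    rw [← LinearMap.range_eq_top, LinearMap.range_comp, Submodule.range_subtype, hC]
  have hsmall : ∀ N : Submodule Λ C, N.map p₁ = ⊤ → N = ⊤ := by
    intro N hN
    have hle : N.map C.subtype ≤ C := Submodule.map_subtype_le C N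
    have hnot := hmin (N.map C.subtype) ⟨hle.trans hCW, by rwa [← Submodule.map_comp]⟩
    have heq : N.map C.subtype = C := by
      by_contra hne
      exact hnot (lt_of_le_of_ne hle hne)
    apply Submodule.map_injective_of_injective C.injective_subtype
    rw [heq, Submodule.map_subtype_top]
  have hind : IsIndecomposableModule Λ C := by
    refine ⟨hp₁.nontrivial, fun N₁ N₂ hc => ?_⟩
    have : N₁.map p₁ ⊔ N₂.map p₁ = ⊤ := by
      rw [← Submodule.map_sup, hc.sup_eq_top, Submodule.map_top, LinearMap.range_eq_top.2 hp₁]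
    have hinf := hc.inf_eq_bot
    rcases hU.eq_top_or_eq_top this with h1 | h2
    · rw [hsmall _ h1, top_inf_eq] at hinf
      exact Or.inr hinf
    · rw [hsmall _ h2, inf_top_eq] at hinf
      exact Or.inl hinf
  have huni : IsUniserialModule Λ C := hNak ⟨C⟩ hind
  have hker : LinearMap.ker p₁ ⊓ LinearMap.ker p₂ = ⊥ := by
    rw [eq_bot_iff]
    rintro ⟨⟨a, b⟩, hx⟩ ⟨ha, hb⟩
    have ha' : a = 0 := ha
    have hb' : b = 0 := hb
    subst ha' hb'
    rfl
  have hinj : Function.Injective p₁ := by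
    rcases huni.eq_bot_or_eq_bot hker with h1 | h2
    · exact LinearMap.ker_eq_bot.1 h1
    · exact OrzechProperty.injective_of_surjective_of_injective p₂ p₁
        (LinearMap.ker_eq_bot.1 h2) hp₁
  let e := LinearEquiv.ofBijective p₁ ⟨hinj, hp₁⟩
  refine ⟨p₂.comp e.symm.toLinearMap, fun u => ?_⟩
  obtain ⟨c, rfl⟩ := e.surjective u
  have hc : h (c : U × U).1 - q (c : U × U).2 = 0 := hCW c.2
  change q (p₂ (e.symm (e c))) = h (p₁ c)
  rw [LinearEquiv.symm_apply_apply]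
  exact (sub_eq_zero.1 hc).symm

/-- A uniserial module over a Nakayama algebra with consecutive factors `B`, `B`, `B'`
(from the socle up) forces `Hom(B', B) ≠ 0`. -/
theorem IsNakayama.not_noHom_of_double_sub [IsArtinianRing Λ] (hNak : IsNakayama Λ)
    (hU : IsUniserialModule Λ U) {B B' : FDModule Λ} (hB : IsBrick B) (hB' : IsBrick B')
    {S T : Submodule Λ U} (hST : S ≤ T) (h₁ : HasFactor ⊥ S B.carrier)
    (h₂ : HasFactor S T B.carrier) (h₃ : HasFactor T ⊤ B'.carrier) : ¬ NoHom B' B := by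
  intro hno
  have := hB.1
  have := hB'.1
  obtain ⟨s₀, hs₀, hs₀'⟩ := h₁.exists_notMem
  obtain ⟨x₀, -, hx₀⟩ := h₃.exists_notMem
  have hT : T ≠ ⊤ := fun h => hx₀ (h ▸ Submodule.mem_top)
  obtain ⟨p, hp, hk⟩ := h₁
  obtain ⟨q, hq, hkq⟩ := id h₂
  have hpi : Function.Injective p := by
    rw [injective_iff_map_eq_zero]
    intro x hx
    exact Subtype.ext (by simpa using (hk x).1 hx)
  let e := LinearEquiv.ofBijective p ⟨hpi, hp⟩
  obtain ⟨φ, hφ⟩ := hNak.exists_extend hU T (S.subtype.comp (e.symm.toLinearMap.comp q))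
  have hφT : ∀ x ∈ T, φ x ∈ S := fun x hx => by
    rw [hφ ⟨x, hx⟩]
    exact (e.symm (q ⟨x, hx⟩)).2
  have hφS : ∀ x ∈ S, φ x = 0 := fun x hx => by
    rw [hφ ⟨x, hST hx⟩]
    simp [(hkq ⟨x, hST hx⟩).2 hx]
  have hSφ : ∀ s ∈ S, ∃ t ∈ T, φ t = s := fun s hs => by
    obtain ⟨t, ht⟩ := hq (e ⟨s, hs⟩)
    exact ⟨t, t.2, by simp [hφ, ht]⟩
  have hφtop : ∀ x ∈ (⊤ : Submodule Λ U), φ x ∈ T := by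
    refine (hB'.map_mem_or h₃ φ (fun _ _ => trivial) fun x hx => hST (hφT x hx)).resolve_right ?_
    rintro ⟨-, hb⟩
    have hsup : LinearMap.range φ ⊔ T = ⊤ := by
      rw [eq_top_iff]
      intro y _
      obtain ⟨x, -, hx⟩ := hb y trivial
      exact Submodule.mem_sup.2 ⟨φ x, ⟨x, rfl⟩, _, hx, by abel⟩
    have hsurj := LinearMap.range_eq_top.1 ((hU.eq_top_or_eq_top hsup).resolve_right hT)
    have hinj := IsNoetherian.injective_of_surjective_endomorphism φ hsurj
    exact hs₀' (hinj (by rw [hφS s₀ hs₀, map_zero]))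
  have hφS' := hno.map_mem h₃ h₂ φ hφtop hφT
  rcases hU (LinearMap.ker φ) T with h | h
  · obtain ⟨t, ht, e⟩ := hSφ _ (hφS' x₀ trivial)
    have : x₀ - t ∈ LinearMap.ker φ := by simp [e]
    exact hx₀ (by simpa using T.add_mem (h this) ht)
  · obtain ⟨t, ht, e⟩ := hSφ s₀ hs₀
    exact hs₀' (by rw [← e]; simpa using h ht)

/-- A uniserial module over a Nakayama algebra with consecutive factors `B`, `B'`, `B'`
(from the socle up) forces `Hom(B', B) ≠ 0`. -/
theorem IsNakayama.not_noHom_of_double_quotient [IsArtinianRing Λ] (hNak : IsNakayama Λ)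
    (hU : IsUniserialModule Λ U) {B B' : FDModule Λ} (hB : IsBrick B) (hB' : IsBrick B')
    {S T : Submodule Λ U} (hST : S ≤ T) (h₁ : HasFactor ⊥ S B.carrier)
    (h₂ : HasFactor S T B'.carrier) (h₃ : HasFactor T ⊤ B'.carrier) : ¬ NoHom B' B := by
  intro hno
  have := hB.1
  have := hB'.1
  obtain ⟨s₀, hs₀, hs₀'⟩ := h₁.exists_notMem
  obtain ⟨t₀, ht₀, ht₀'⟩ := h₂.exists_notMem
  obtain ⟨x₀, -, hx₀⟩ := h₃.exists_notMem
  obtain ⟨q, hq, hkq⟩ := id h₂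
  obtain ⟨r, hr, hkr⟩ := h₃
  obtain ⟨β, hβ⟩ := LinearMap.exists_factor_of_surjective q hq (S.mkQ.comp T.subtype)
    fun x hx => by simpa using (hkq x).1 hx
  obtain ⟨φ, hφ⟩ := hNak.exists_lift hU S.mkQ S.mkQ_surjective
    (β.comp (r.comp (Submodule.topEquiv (R := Λ) (M := U)).symm.toLinearMap))
  have hφq : ∀ u, ∀ t : T, r ⟨u, trivial⟩ = q t → φ u - t ∈ S := fun u t h => by
    have h1 : S.mkQ (φ u) = β (r ⟨u, trivial⟩) := hφ u
    rw [h, hβ] at h1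
    exact (Submodule.Quotient.eq S).1 h1
  have hφtop : ∀ u, φ u ∈ T := fun u => by
    obtain ⟨t, ht⟩ := hq (r ⟨u, trivial⟩)
    simpa using T.add_mem (hST (hφq u t ht.symm)) t.2
  have hφT : ∀ x ∈ T, φ x ∈ S := fun x hx => by
    simpa using hφq x 0 (by rw [map_zero]; exact (hkr _).2 hx)
  have hφT' : ∀ x, φ x ∈ S → x ∈ T := fun x hx => by
    obtain ⟨t, ht⟩ := hq (r ⟨x, trivial⟩)
    have h1 : (t : U) ∈ S := by simpa using S.sub_mem hx (hφq x t ht.symm)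
    rw [(hkq t).2 h1] at ht
    exact (hkr ⟨x, trivial⟩).1 ht.symm
  have hSr : S ≤ LinearMap.range φ := by
    refine (hU S (LinearMap.range φ)).resolve_right fun h => ?_
    exact hx₀ (hφT' x₀ (h ⟨x₀, rfl⟩))
  have hφS : ∀ x ∈ S, φ x ∈ (⊥ : Submodule Λ U) := by
    refine (hB.map_mem_or h₁ φ (fun x hx => hφT x (hST hx)) (by simp)).resolve_right ?_
    rintro ⟨hi, -⟩
    have hker : LinearMap.ker φ ⊓ S = ⊥ := by
      rw [eq_bot_iff]
      rintro x ⟨hx, hxS⟩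
      exact hi x hxS (by simpa using hx)
    rcases hU.eq_bot_or_eq_bot hker with h | h
    · have hsurj := IsArtinian.surjective_of_injective_endomorphism φ (LinearMap.ker_eq_bot.1 h)
      obtain ⟨u, rfl⟩ := hsurj x₀
      exact hx₀ (hφtop u)
    · exact hs₀' (h ▸ hs₀)
  have h0 := hno.map_mem h₂ h₁ φ hφT hφS
  obtain ⟨u, hu⟩ := hSr hs₀
  exact hs₀' (hu ▸ h0 u (hφT' u (hu ▸ hs₀)))

/-- A uniserial extension of a brick `B'` by a brick `B` with `Hom(B', B) = 0` has only
zero and bijective endomorphisms. -/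
theorem IsUniserialModule.eq_zero_or_bijective [IsArtinianRing Λ]
    (hU : IsUniserialModule Λ U) {B B' : FDModule Λ} (hB : IsBrick B) (hB' : IsBrick B')
    (hno : NoHom B' B) {S : Submodule Λ U} (h₁ : HasFactor ⊥ S B.carrier)
    (h₂ : HasFactor S ⊤ B'.carrier) (φ : U →ₗ[Λ] U) : φ = 0 ∨ Function.Bijective φ := by
  by_contra! hcon
  obtain ⟨hne, hbij⟩ := hcon
  have hninj : ¬ Function.Injective φ := fun h =>
    hbij ⟨h, IsArtinian.surjective_of_injective_endomorphism φ h⟩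
  have hnsurj : ¬ Function.Surjective φ := fun h =>
    hbij ⟨IsNoetherian.injective_of_surjective_endomorphism φ h, h⟩
  have := hB.1
  have := hB'.1
  obtain ⟨s₀, hs₀, hs₀'⟩ := h₁.exists_notMem
  obtain ⟨x₀, -, hx₀⟩ := h₂.exists_notMem
  have hker : ¬ LinearMap.ker φ ⊓ S = ⊥ := fun h => by
    rcases hU.eq_bot_or_eq_bot h with h | h
    · exact hninj (LinearMap.ker_eq_bot.1 h)
    · exact hs₀' (h ▸ hs₀)
  have hφS : ∀ x ∈ S, φ x ∈ S := by
    rcases hU (S.map φ) S with h | h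
    · exact fun x hx => h ⟨x, hx, rfl⟩
    · exfalso
      let S' : Submodule Λ U := S ⊓ S.comap φ
      let i : S' →ₗ[Λ] S := Submodule.inclusion inf_le_left
      let k : S' →ₗ[Λ] S := φ.restrict fun x hx => hx.2
      have hk : Function.Surjective k := by
        rintro ⟨y, hy⟩
        obtain ⟨x, hx, rfl⟩ := h hy
        exact ⟨⟨x, hx, hy⟩, rfl⟩
      have hki := OrzechProperty.injective_of_surjective_of_injective i k
        (Submodule.inclusion_injective _) hk
      refine hker (eq_bot_iff.2 ?_)
      rintro x ⟨hx, hxS⟩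
      have hx0 : φ x = 0 := hx
      have hxS' : x ∈ S' := ⟨hxS, by simp [hx0]⟩
      have : (⟨x, hxS'⟩ : S') = 0 := hki (Subtype.ext (by simp [k, hx0]))
      simpa using congrArg Subtype.val this
  have hS0 : ∀ x ∈ S, φ x ∈ (⊥ : Submodule Λ U) := by
    refine (hB.map_mem_or h₁ φ hφS (by simp)).resolve_right ?_
    rintro ⟨hi, -⟩
    refine hker (eq_bot_iff.2 ?_)
    rintro x ⟨hx, hxS⟩
    exact hi x hxS (by simpa using hx)
  have htop : ∀ x ∈ (⊤ : Submodule Λ U), φ x ∈ S := by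
    refine (hB'.map_mem_or h₂ φ (fun _ _ => trivial) hφS).resolve_right ?_
    rintro ⟨-, hb⟩
    have hsup : LinearMap.range φ ⊔ S = ⊤ := by
      rw [eq_top_iff]
      intro y _
      obtain ⟨x, -, hx⟩ := hb y trivial
      exact Submodule.mem_sup.2 ⟨φ x, ⟨x, rfl⟩, _, hx, by abel⟩
    rcases hU.eq_top_or_eq_top hsup with h | h
    · exact hnsurj (LinearMap.range_eq_top.1 h)
    · exact hx₀ (h ▸ Submodule.mem_top)
  have h0 := hno.map_mem h₂ h₁ φ htop hS0
  exact hne (LinearMap.ext fun x => by simpa using h0 x trivial)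

/-- Factors of a chain `A ≤ S ≤ T ≤ Q` are the factors of a chain in the subquotient `Q / A`. -/
theorem exists_subquotient_chain [IsNoetherianRing Λ] (hU : IsUniserialModule Λ U)
    {A S T Q : Submodule Λ U} (hAS : A ≤ S) (hST : S ≤ T) (hTQ : T ≤ Q)
    {X₁ X₂ X₃ : FDModule Λ} (h₁ : HasFactor A S X₁.carrier) (h₂ : HasFactor S T X₂.carrier)
    (h₃ : HasFactor T Q X₃.carrier) :
    ∃ (Y : FDModule Λ) (S' T' : Submodule Λ Y.carrier), IsUniserialModule Λ Y.carrier ∧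
      S' ≤ T' ∧ HasFactor ⊥ S' X₁.carrier ∧ HasFactor S' T' X₂.carrier ∧
      HasFactor T' ⊤ X₃.carrier := by
  let A' : Submodule Λ Q := A.comap Q.subtype
  have key : ∀ {C D : Submodule Λ U} {X : FDModule Λ}, A ≤ C → D ≤ Q →
      HasFactor C D X.carrier → HasFactor ((C.comap Q.subtype).map A'.mkQ)
        ((D.comap Q.subtype).map A'.mkQ) X.carrier := fun hC hD h =>
    (h.comap Q.subtype (by simpa using hD)).map_of_ker_le A'.mkQ
      (by rw [Submodule.ker_mkQ]; exact Submodule.comap_mono hC)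
  have k₁ := key le_rfl (hST.trans hTQ) h₁
  have k₂ := key hAS hTQ h₂
  have k₃ := key (hAS.trans hST) le_rfl h₃
  rw [show (A.comap Q.subtype).map A'.mkQ = ⊥ from Submodule.mkQ_map_self A'] at k₁
  rw [Submodule.comap_subtype_self, Submodule.map_top, Submodule.range_mkQ] at k₃
  exact ⟨⟨Q ⧸ A'⟩, _, _, (hU.submodule Q).quotient A',
    Submodule.map_mono (Submodule.comap_mono hST), k₁, k₂, k₃⟩

end Nakayama

/-- over a Nakayama algebra, if `B`, `B'` are bricks with
`Hom(B', B) = 0`, `L` is indecomposable in `Filt(B)`, `N` is indecomposable in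
`Filt(B')`, then the middle term of every non-split short exact sequence
`0 → L → M → N → 0` with `M` indecomposable is a brick. -/
theorem statement_11 (K : Type) [Field K] (Λ : Type) [Ring Λ] [Algebra K Λ]
    [FiniteDimensional K Λ] (hNak : IsNakayama Λ)
    (B B' : FDModule Λ) (hB : IsBrick B) (hB' : IsBrick B') (hBB' : NoHom B' B)
    (L : FDModule Λ) (hLind : IsIndecomposableModule Λ L.carrier)
    (hLF : InFilt B L.carrier)
    (N : FDModule Λ) (hNind : IsIndecomposableModule Λ N.carrier)
    (hNF : InFilt B' N.carrier)
    (M : FDModule Λ) (hMind : IsIndecomposableModule Λ M.carrier)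
    (f : L.carrier →ₗ[Λ] M.carrier) (g : M.carrier →ₗ[Λ] N.carrier)
    (hse : IsShortExact f g) (hns : ¬ SESSplits g) :
    IsBrick M := by
  have : IsArtinianRing Λ := IsArtinianRing.of_finite K Λ
  have hU : IsUniserialModule Λ M.carrier := hNak M hMind
  obtain ⟨hf, hfg, hg⟩ := hse
  have hLnt := hLind.1
  have hNnt := hNind.1
  obtain ⟨t, c, hc, hc0, hct, hcf⟩ := hLF
  obtain ⟨u, d, hd, hd0, hdu, hdf⟩ := hNF
  have hcF : ∀ k : Fin t, HasFactor ((c k.castSucc).map f) ((c k.succ).map f) B.carrier :=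
    fun k => (hasFactor_of_equiv (hcf k).some).map_injective f hf
  have hdF : ∀ k : Fin u, HasFactor ((d k.castSucc).comap g) ((d k.succ).comap g) B'.carrier :=
    fun k => (hasFactor_of_equiv (hdf k).some).comap g
      (by rw [LinearMap.range_eq_top.2 hg]; exact le_top)
  have hcm : ∀ k : Fin t, (c k.castSucc).map f ≤ (c k.succ).map f := fun k =>
    Submodule.map_mono (hc k.castSucc_lt_succ.le)
  have hdm : ∀ k : Fin u, (d k.castSucc).comap g ≤ (d k.succ).comap g := fun k =>
    Submodule.comap_mono (hd k.castSucc_lt_succ.le)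
  have hmid : (c (Fin.last t)).map f = (d 0).comap g := by
    rw [hct, hd0, Submodule.map_top, hfg, LinearMap.ker]
  obtain _ | t := t
  · exact absurd (hc0.symm.trans hct) bot_ne_top
  obtain _ | u := u
  · exact absurd (hd0.symm.trans hdu) bot_ne_top
  have hLtop := hcF (Fin.last t)
  have hLm := hcm (Fin.last t)
  rw [Fin.succ_last, hmid] at hLtop hLm
  have hNbot := hdF 0
  have hNm := hdm 0
  rw [Fin.castSucc_zero] at hNbot hNm
  obtain _ | t := t
  · obtain _ | u := u
    · have h0 : (c (Fin.last 0).castSucc).map f = ⊥ := by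
        rw [show (Fin.last 0).castSucc = (0 : Fin 2) from rfl, hc0, Submodule.map_bot]
      have h1 : (d (Fin.succ 0)).comap g = ⊤ := by
        rw [show Fin.succ (0 : Fin 1) = Fin.last 1 from rfl, hdu, Submodule.comap_top]
      rw [h0] at hLtop
      rw [h1] at hNbot
      exact ⟨hMind.1, hU.eq_zero_or_bijective hB hB' hBB' hLtop hNbot⟩
    · obtain ⟨Y, S', T', hY, hle, k₁, k₂, k₃⟩ :=
        exists_subquotient_chain hU hLm hNm (hdm 1) hLtop hNbot (hdF 1)
      exact absurd hBB' (hNak.not_noHom_of_double_quotient hY hB hB' hle k₁ k₂ k₃)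
  · have hL' := hcF (Fin.last t).castSucc
    have hLm' := hcm (Fin.last t).castSucc
    rw [Fin.succ_castSucc, Fin.succ_last] at hL' hLm'
    obtain ⟨Y, S', T', hY, hle, k₁, k₂, k₃⟩ :=
      exists_subquotient_chain hU hLm' hLm hNm hL' hLtop hNbot
    exact absurd hBB' (hNak.not_noHom_of_double_sub hY hB hB' hle k₁ k₂ k₃)
end
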